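/- arXiv:2511.12198 — 2 statements merged into one kernel-verified Lean document; each statement's English description precedes it below -/
import Mathlib

section
/- Let Λ be a finite-dimensional algebra over a field K. The following are equivalent: (1) Λ is brick-finite; (2) the set of wide subcategories of mod Λ is finite; (3) the set of functorially finite wide subcategories of mod Λ is finite; (4) the set of functorially finite wide subcategories W of mod Λ for which the smallest torsion class T(W) containing W is a functorially finite torsion class is finite. -/
open Function DirectSum

namespace BrickPaper

variable (Λ : Type) [Ring Λ]

/-- `M` belongs to `mod Λ`, i.e. is a finitely generated module. -/
abbrev FG (M : ModuleCat.{0} Λ) : Prop := Module.Finite Λ M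

/-- A class of modules closed under isomorphism. -/
def IsoClosed (C : Set (ModuleCat.{0} Λ)) : Prop :=
  ∀ ⦃M N : ModuleCat.{0} Λ⦄, Nonempty (M ≃ₗ[Λ] N) → M ∈ C → N ∈ C

/-- A class of modules containing the zero modules. -/
def HasZeroObj (C : Set (ModuleCat.{0} Λ)) : Prop :=
  ∀ M : ModuleCat.{0} Λ, Subsingleton M → M ∈ C

/-- Closure under extensions: if `0 → A → M → B → 0` is exact with `A, B ∈ C` then `M ∈ C`. -/
def ExtClosed (C : Set (ModuleCat.{0} Λ)) : Prop :=
  ∀ ⦃A M B : ModuleCat.{0} Λ⦄ (f : A →ₗ[Λ] M) (g : M →ₗ[Λ] B),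
    Function.Injective f → Function.Surjective g →
    LinearMap.range f = LinearMap.ker g → A ∈ C → B ∈ C → M ∈ C

/-- Closure under quotients (images of surjections). -/
def QuotClosed (C : Set (ModuleCat.{0} Λ)) : Prop :=
  ∀ ⦃M N : ModuleCat.{0} Λ⦄ (g : M →ₗ[Λ] N), Function.Surjective g → M ∈ C → N ∈ C

/-- Closure under submodules (sources of injections). -/
def SubClosed (C : Set (ModuleCat.{0} Λ)) : Prop :=
  ∀ ⦃M N : ModuleCat.{0} Λ⦄ (f : M →ₗ[Λ] N), Function.Injective f → N ∈ C → M ∈ C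

/-- Closure under kernels of morphisms between members. -/
def KerClosed (C : Set (ModuleCat.{0} Λ)) : Prop :=
  ∀ ⦃M N : ModuleCat.{0} Λ⦄ (f : M →ₗ[Λ] N), M ∈ C → N ∈ C →
    ModuleCat.of Λ ↥(LinearMap.ker f) ∈ C

/-- Closure under cokernels of morphisms between members. -/
def CokerClosed (C : Set (ModuleCat.{0} Λ)) : Prop :=
  ∀ ⦃M N : ModuleCat.{0} Λ⦄ (f : M →ₗ[Λ] N), M ∈ C → N ∈ C →
    ModuleCat.of Λ ((N : Type) ⧸ LinearMap.range f) ∈ C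

/-- A wide subcategory of `mod Λ`: a class of finitely generated modules, closed under
isomorphisms, containing `0`, and closed under kernels, cokernels and extensions. -/
def IsWide (C : Set (ModuleCat.{0} Λ)) : Prop :=
  (∀ M ∈ C, FG Λ M) ∧ IsoClosed Λ C ∧ HasZeroObj Λ C ∧
    KerClosed Λ C ∧ CokerClosed Λ C ∧ ExtClosed Λ C

/-- A wide subcategory of the big module category `Mod Λ` (no finiteness condition). -/
def IsWideBig (C : Set (ModuleCat.{0} Λ)) : Prop :=
  IsoClosed Λ C ∧ HasZeroObj Λ C ∧ KerClosed Λ C ∧ CokerClosed Λ C ∧ ExtClosed Λ C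

/-- A torsion class in `mod Λ`: closed under quotients and extensions. -/
def IsTorsionClass (C : Set (ModuleCat.{0} Λ)) : Prop :=
  (∀ M ∈ C, FG Λ M) ∧ IsoClosed Λ C ∧ HasZeroObj Λ C ∧ QuotClosed Λ C ∧ ExtClosed Λ C

/-- A torsion-free class in `mod Λ`: closed under submodules and extensions. -/
def IsTorsionFreeClass (C : Set (ModuleCat.{0} Λ)) : Prop :=
  (∀ M ∈ C, FG Λ M) ∧ IsoClosed Λ C ∧ HasZeroObj Λ C ∧ SubClosed Λ C ∧ ExtClosed Λ C

/-- The smallest torsion class containing `X`. -/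
def torsClosure (X : Set (ModuleCat.{0} Λ)) : Set (ModuleCat.{0} Λ) :=
  ⋂₀ {C | IsTorsionClass Λ C ∧ X ⊆ C}

/-- The smallest torsion-free class containing `X`. -/
def torfClosure (X : Set (ModuleCat.{0} Λ)) : Set (ModuleCat.{0} Λ) :=
  ⋂₀ {C | IsTorsionFreeClass Λ C ∧ X ⊆ C}

/-- A widely generated torsion class. -/
def IsWidelyGenTors (T : Set (ModuleCat.{0} Λ)) : Prop :=
  IsTorsionClass Λ T ∧ ∃ W, IsWide Λ W ∧ T = torsClosure Λ W

/-- A widely generated torsion-free class. -/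
def IsWidelyGenTorf (F : Set (ModuleCat.{0} Λ)) : Prop :=
  IsTorsionFreeClass Λ F ∧ ∃ W, IsWide Λ W ∧ F = torfClosure Λ W

/-- A finitely generated torsion class: generated by a single module of `mod Λ`. -/
def IsFinGenTors (T : Set (ModuleCat.{0} Λ)) : Prop :=
  IsTorsionClass Λ T ∧ ∃ M : ModuleCat.{0} Λ, FG Λ M ∧ T = torsClosure Λ {M}

/-- `T' ` covers `T` in the poset of torsion classes. -/
def TorsCovers (T' T : Set (ModuleCat.{0} Λ)) : Prop :=
  IsTorsionClass Λ T' ∧ T ⊂ T' ∧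
    ∀ T'', IsTorsionClass Λ T'' → T ⊂ T'' → T'' ⊆ T' → T'' = T'

/-- `F'` covers `F` in the poset of torsion-free classes. -/
def TorfCovers (F' F : Set (ModuleCat.{0} Λ)) : Prop :=
  IsTorsionFreeClass Λ F' ∧ F ⊂ F' ∧
    ∀ F'', IsTorsionFreeClass Λ F'' → F ⊂ F'' → F'' ⊆ F' → F'' = F'

/-- A brick: a finitely generated module whose endomorphism ring is a division ring. -/
def IsBrick (M : ModuleCat.{0} Λ) : Prop :=
  FG Λ M ∧ Nontrivial M ∧ ∀ f : M →ₗ[Λ] M, f ≠ 0 → Function.Bijective f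

/-- A semibrick, regarded as an isomorphism-closed class of bricks (i.e. a set of
isomorphism classes of bricks) which are pairwise Hom-orthogonal. -/
def IsSemibrick (S : Set (ModuleCat.{0} Λ)) : Prop :=
  (∀ M ∈ S, IsBrick Λ M) ∧ IsoClosed Λ S ∧
    ∀ M ∈ S, ∀ N ∈ S, IsEmpty (M ≃ₗ[Λ] N) → ∀ f : M →ₗ[Λ] N, f = 0

/-- A monobrick, regarded as an isomorphism-closed class of bricks (i.e. a set of
isomorphism classes of bricks) such that every morphism between members is zero or injective. -/
def IsMonobrick (S : Set (ModuleCat.{0} Λ)) : Prop :=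
  (∀ M ∈ S, IsBrick Λ M) ∧ IsoClosed Λ S ∧
    ∀ M ∈ S, ∀ N ∈ S, ∀ f : M →ₗ[Λ] N, f = 0 ∨ Function.Injective f

/-- `N` is a cofinal extension of the monobrick `M`. -/
def IsCofinalExtension (M N : Set (ModuleCat.{0} Λ)) : Prop :=
  IsMonobrick Λ N ∧ M ⊆ N ∧
    ∀ X ∈ N, ∃ Y ∈ M, ∃ f : X →ₗ[Λ] Y, Function.Injective f

/-- A cofinally closed monobrick: a monobrick with no proper cofinal extension. -/
def IsCofinallyClosed (M : Set (ModuleCat.{0} Λ)) : Prop :=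
  IsMonobrick Λ M ∧ ∀ N, IsCofinalExtension Λ M N → N = M

/-- `S` contains only finitely many modules up to isomorphism. -/
def FiniteUpToIso (S : Set (ModuleCat.{0} Λ)) : Prop :=
  ∃ B : Set (ModuleCat.{0} Λ), B.Finite ∧ ∀ M ∈ S, ∃ N ∈ B, Nonempty (M ≃ₗ[Λ] N)

/-- `Λ` is brick-finite: there are only finitely many bricks up to isomorphism. -/
def BrickFinite : Prop := FiniteUpToIso Λ {M | IsBrick Λ M}

/-- Right Hom-perpendicular class `T^⊥` inside `mod Λ`. -/
def rPerp (T : Set (ModuleCat.{0} Λ)) : Set (ModuleCat.{0} Λ) :=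
  {M | FG Λ M ∧ ∀ X ∈ T, ∀ f : X →ₗ[Λ] M, f = 0}

/-- Left Hom-perpendicular class `^⊥F` inside `mod Λ`. -/
def lPerp (F : Set (ModuleCat.{0} Λ)) : Set (ModuleCat.{0} Λ) :=
  {M | FG Λ M ∧ ∀ Y ∈ F, ∀ f : M →ₗ[Λ] Y, f = 0}

/-- A minimal extending module for a torsion class `T`. -/
def IsMinExt (T : Set (ModuleCat.{0} Λ)) (M : ModuleCat.{0} Λ) : Prop :=
  FG Λ M ∧ Nontrivial M ∧
    (∀ S : Submodule Λ M, S ≠ ⊥ → ModuleCat.of Λ ((M : Type) ⧸ S) ∈ T) ∧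
    (∀ (X T' : ModuleCat.{0} Λ) (f : M →ₗ[Λ] X) (g : X →ₗ[Λ] T'),
      Function.Injective f → Function.Surjective g →
      LinearMap.range f = LinearMap.ker g → T' ∈ T →
      (¬ ∃ r : X →ₗ[Λ] M, r ∘ₗ f = LinearMap.id) → X ∈ T) ∧
    (∀ X ∈ T, ∀ f : X →ₗ[Λ] M, f = 0)

/-- A minimal co-extending module for a torsion-free class `F`. -/
def IsMinCoext (F : Set (ModuleCat.{0} Λ)) (M : ModuleCat.{0} Λ) : Prop :=
  FG Λ M ∧ Nontrivial M ∧
    (∀ S : Submodule Λ M, S ≠ ⊤ → ModuleCat.of Λ ↥S ∈ F) ∧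
    (∀ (X F' : ModuleCat.{0} Λ) (f : F' →ₗ[Λ] X) (g : X →ₗ[Λ] M),
      Function.Injective f → Function.Surjective g →
      LinearMap.range f = LinearMap.ker g → F' ∈ F →
      (¬ ∃ s : M →ₗ[Λ] X, g ∘ₗ s = LinearMap.id) → X ∈ F) ∧
    (∀ Y ∈ F, ∀ f : M →ₗ[Λ] Y, f = 0)

/-- The set (of representatives of isomorphism classes) of minimal extending modules. -/
def ME (T : Set (ModuleCat.{0} Λ)) : Set (ModuleCat.{0} Λ) := {M | IsMinExt Λ T M}

/-- The set (of representatives of isomorphism classes) of minimal co-extending modules. -/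
def MCE (F : Set (ModuleCat.{0} Λ)) : Set (ModuleCat.{0} Λ) := {M | IsMinCoext Λ F M}

/-- `M` admits a finite filtration with subquotients isomorphic to members of `B`. -/
def FiltMem (B : Set (ModuleCat.{0} Λ)) (M : ModuleCat.{0} Λ) : Prop :=
  ∃ (n : ℕ) (c : Fin (n + 1) → Submodule Λ M), Monotone c ∧ c 0 = ⊥ ∧ c (Fin.last n) = ⊤ ∧
    ∀ i : Fin n, ∃ N ∈ B,
      Nonempty ((↥(c i.succ) ⧸ Submodule.comap (c i.succ).subtype (c i.castSucc)) ≃ₗ[Λ] N)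

/-- `Filt B`. -/
def filtClosure (B : Set (ModuleCat.{0} Λ)) : Set (ModuleCat.{0} Λ) :=
  {M | FiltMem Λ B M}

/-- The simple objects of a subcategory `C`, i.e. nonzero members with no proper nonzero
subobject belonging to `C`. -/
def simOf (C : Set (ModuleCat.{0} Λ)) : Set (ModuleCat.{0} Λ) :=
  {M | M ∈ C ∧ Nontrivial M ∧
    ∀ (X : ModuleCat.{0} Λ) (f : X →ₗ[Λ] M), X ∈ C → Function.Injective f →
      LinearMap.range f = ⊥ ∨ LinearMap.range f = ⊤}

/-- The subcategory `α(T) = {X ∈ T : for all g : Y → X with Y ∈ T, ker g ∈ T}`. -/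
def alphaOf (T : Set (ModuleCat.{0} Λ)) : Set (ModuleCat.{0} Λ) :=
  {X | X ∈ T ∧ ∀ (Y : ModuleCat.{0} Λ) (g : Y →ₗ[Λ] X), Y ∈ T →
    ModuleCat.of Λ ↥(LinearMap.ker g) ∈ T}

/-- Covariantly finite subcategory of `mod Λ`. -/
def CovariantlyFinite (B : Set (ModuleCat.{0} Λ)) : Prop :=
  ∀ M : ModuleCat.{0} Λ, FG Λ M → ∃ N ∈ B, ∃ f : M →ₗ[Λ] N,
    ∀ N' ∈ B, ∀ g : M →ₗ[Λ] N', ∃ h : N →ₗ[Λ] N', h ∘ₗ f = g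

/-- Contravariantly finite subcategory of `mod Λ`. -/
def ContravariantlyFinite (B : Set (ModuleCat.{0} Λ)) : Prop :=
  ∀ M : ModuleCat.{0} Λ, FG Λ M → ∃ N ∈ B, ∃ f : N →ₗ[Λ] M,
    ∀ N' ∈ B, ∀ g : N' →ₗ[Λ] M, ∃ h : N' →ₗ[Λ] N, f ∘ₗ h = g

/-- Functorially finite subcategory of `mod Λ`. -/
def FunctoriallyFinite (B : Set (ModuleCat.{0} Λ)) : Prop :=
  CovariantlyFinite Λ B ∧ ContravariantlyFinite Λ B

/-- Closure under (set-indexed) coproducts. -/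
def CoprodClosed (C : Set (ModuleCat.{0} Λ)) : Prop :=
  ∀ (ι : Type) (M : ι → ModuleCat.{0} Λ), (∀ i, M i ∈ C) →
    ModuleCat.of Λ (⨁ i, (M i : Type)) ∈ C

/-- Closure under (set-indexed) products. -/
def ProdClosed (C : Set (ModuleCat.{0} Λ)) : Prop :=
  ∀ (ι : Type) (M : ι → ModuleCat.{0} Λ), (∀ i, M i ∈ C) →
    ModuleCat.of Λ ((i : ι) → (M i : Type)) ∈ C

/-! Lattice-theoretic notions in the complete lattice of torsion classes. -/

/-- The join of a set of torsion classes. -/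
def torsJoin (X : Set (Set (ModuleCat.{0} Λ))) : Set (ModuleCat.{0} Λ) :=
  torsClosure Λ (⋃₀ X)

/-- The meet of a set of torsion classes (inside the lattice of torsion classes,
whose top element is `mod Λ`). -/
def torsMeet (X : Set (Set (ModuleCat.{0} Λ))) : Set (ModuleCat.{0} Λ) :=
  {M | FG Λ M} ∩ ⋂₀ X

/-- A completely join-irreducible torsion class. -/
def CompletelyJoinIrred (J : Set (ModuleCat.{0} Λ)) : Prop :=
  IsTorsionClass Λ J ∧
    ∀ X : Set (Set (ModuleCat.{0} Λ)), (∀ a ∈ X, IsTorsionClass Λ a) →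
      torsJoin Λ X = J → J ∈ X

/-- `J_* = ⋁ {x : x < J}`. -/
def jstar (J : Set (ModuleCat.{0} Λ)) : Set (ModuleCat.{0} Λ) :=
  torsJoin Λ {C | IsTorsionClass Λ C ∧ C ⊂ J}

/-- `k = κ(J) = max {x : J ∧ x = J_*}`. -/
def IsKappa (J k : Set (ModuleCat.{0} Λ)) : Prop :=
  IsTorsionClass Λ k ∧ J ∩ k = jstar Λ J ∧
    ∀ C, IsTorsionClass Λ C → J ∩ C = jstar Λ J → C ⊆ k

/-- `A` is a join representation of the torsion class `T`. -/
def IsJoinRep (T : Set (ModuleCat.{0} Λ)) (A : Set (Set (ModuleCat.{0} Λ))) : Prop :=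
  (∀ a ∈ A, IsTorsionClass Λ a) ∧ torsJoin Λ A = T

/-- `A` refines `B`. -/
def Refines (A B : Set (Set (ModuleCat.{0} Λ))) : Prop :=
  ∀ a ∈ A, ∃ b ∈ B, a ⊆ b

/-- `A` is the canonical join representation of `T`. -/
def IsCJR (T : Set (ModuleCat.{0} Λ)) (A : Set (Set (ModuleCat.{0} Λ))) : Prop :=
  IsJoinRep Λ T A ∧ (∀ B, IsJoinRep Λ T B → Refines Λ A B) ∧
    ∀ a ∈ A, ∀ b ∈ A, a ⊆ b → a = b

/-- `Kb = κ̄(T) = ⋀ {κ(j) : j ∈ CJR(T)}`, the extended kappa map. -/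
def IsKappaBar (T Kb : Set (ModuleCat.{0} Λ)) : Prop :=
  ∃ A, IsCJR Λ T A ∧ (∀ j ∈ A, CompletelyJoinIrred Λ j) ∧
    (∀ j ∈ A, ∃ k, IsKappa Λ j k) ∧
    Kb = torsMeet Λ {k | ∃ j ∈ A, IsKappa Λ j k}

/-- The kappa order: `a ≤_κ b` iff `a ≤ b` and `κ̄(a) ≥ κ̄(b)`. -/
def KappaLE (a b : Set (ModuleCat.{0} Λ)) : Prop :=
  a ⊆ b ∧ ∀ Ka Kb, IsKappaBar Λ a Ka → IsKappaBar Λ b Kb → Kb ⊆ Ka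

section Preliminaries

/-- The trace of `V` in `X`: the sum of the images of all morphisms `V → X`. -/
def moduleTrace (V X : Type) [AddCommGroup V] [Module Λ V] [AddCommGroup X] [Module Λ X] :
    Submodule Λ X :=
  ⨆ f : V →ₗ[Λ] X, LinearMap.range f

/-- Hom-spaces between finitely generated modules are finitely generated, on both sides, by
endomorphisms, and endomorphism rings of finitely generated modules are Artinian. -/
class IsHomFinite : Prop where
  exists_family : ∀ (M N : Type) [AddCommGroup M] [Module Λ M] [AddCommGroup N] [Module Λ N]
    [Module.Finite Λ M] [Module.Finite Λ N], ∃ (n : ℕ) (f : Fin n → (M →ₗ[Λ] N)),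
      ∀ g : M →ₗ[Λ] N,
        (∃ a : Fin n → (N →ₗ[Λ] N), g = ∑ i, a i ∘ₗ f i) ∧
        (∃ b : Fin n → (M →ₗ[Λ] M), g = ∑ i, f i ∘ₗ b i)
  isArtinianRing_end : ∀ (M : Type) [AddCommGroup M] [Module Λ M] [Module.Finite Λ M],
    IsArtinianRing (Module.End Λ M)

variable {Λ}

theorem isHomFinite_of_finiteDimensional (K : Type) [Field K] [Algebra K Λ]
    [FiniteDimensional K Λ] : IsHomFinite Λ where
  exists_family M N _ _ _ _ _ _ := by
    let : Module K M := Module.compHom M (algebraMap K Λ)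
    have : IsScalarTower K Λ M :=
      ⟨fun a b m => by rw [Algebra.smul_def, mul_smul]; rfl⟩
    let : Module K N := Module.compHom N (algebraMap K Λ)
    have : IsScalarTower K Λ N :=
      ⟨fun a b m => by rw [Algebra.smul_def, mul_smul]; rfl⟩
    have : Module.Finite K M := Module.Finite.trans Λ M
    have : Module.Finite K N := Module.Finite.trans Λ N
    obtain ⟨n, f, hf⟩ := Module.Finite.exists_fin (R := K) (M := M →ₗ[Λ] N)
    refine ⟨n, f, fun g => ?_⟩
    have hg : g ∈ Submodule.span K (Set.range f) := hf ▸ Submodule.mem_top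
    obtain ⟨c, rfl⟩ := (Submodule.mem_span_range_iff_exists_fun K).1 hg
    refine ⟨⟨fun i => c i • LinearMap.id, ?_⟩, ⟨fun i => c i • LinearMap.id, ?_⟩⟩
    · exact Finset.sum_congr rfl fun i _ => by ext; simp
    · refine Finset.sum_congr rfl fun i _ => ?_
      ext m
      simp only [LinearMap.smul_apply, LinearMap.comp_apply, LinearMap.id_apply]
      exact ((f i).map_smul_of_tower (c i) m).symm
  isArtinianRing_end M _ _ _ := by
    let : Module K M := Module.compHom M (algebraMap K Λ)
    have : IsScalarTower K Λ M :=
      ⟨fun a b m => by rw [Algebra.smul_def, mul_smul]; rfl⟩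
    have : Module.Finite K M := Module.Finite.trans Λ M
    have : Module.Finite K (Module.End Λ M) :=
      inferInstanceAs (Module.Finite K (M →ₗ[Λ] M))
    exact IsArtinianRing.of_finite K (Module.End Λ M)

variable {V X Y Z : Type} [AddCommGroup V] [Module Λ V] [AddCommGroup X] [Module Λ X]
  [AddCommGroup Y] [Module Λ Y] [AddCommGroup Z] [Module Λ Z]

theorem apply_mem_moduleTrace (f : V →ₗ[Λ] X) (v : V) : f v ∈ moduleTrace Λ V X :=
  Submodule.mem_iSup_of_mem f ⟨v, rfl⟩

theorem moduleTrace_le {p : Submodule Λ X} (h : ∀ (f : V →ₗ[Λ] X) v, f v ∈ p) :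
    moduleTrace Λ V X ≤ p :=
  iSup_le fun f => by rintro _ ⟨v, rfl⟩; exact h f v

theorem moduleTrace_le_comap (g : X →ₗ[Λ] Y) :
    moduleTrace Λ V X ≤ (moduleTrace Λ V Y).comap g :=
  moduleTrace_le fun f v => apply_mem_moduleTrace (g ∘ₗ f) v

theorem moduleTrace_le_of_moduleTrace_eq_top (h : moduleTrace Λ V X = ⊤) :
    moduleTrace Λ X Y ≤ moduleTrace Λ V Y :=
  moduleTrace_le fun f _ => moduleTrace_le_comap f (h ▸ Submodule.mem_top)

theorem moduleTrace_self : moduleTrace Λ X X = ⊤ :=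
  eq_top_iff.2 fun x _ => apply_mem_moduleTrace LinearMap.id x

/-- The morphism `V^n → X` with given components. -/
def powDesc {n : ℕ} (f : Fin n → (V →ₗ[Λ] X)) : (Fin n → V) →ₗ[Λ] X :=
  ∑ i, f i ∘ₗ LinearMap.proj i

theorem powDesc_apply {n : ℕ} (f : Fin n → (V →ₗ[Λ] X)) (v : Fin n → V) :
    powDesc f v = ∑ i, f i (v i) := by
  simp [powDesc]

theorem powDesc_single {n : ℕ} (f : Fin n → (V →ₗ[Λ] X)) (i : Fin n) (v : V) :
    powDesc f (Pi.single i v) = f i v := by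
  rw [powDesc_apply, Finset.sum_eq_single i]
  · simp
  · intro j _ hj
    simp [Pi.single_eq_of_ne hj]
  · simp

theorem exists_powDesc_surjective [Module.Finite Λ X] (h : moduleTrace Λ V X = ⊤) :
    ∃ (n : ℕ) (p : (Fin n → V) →ₗ[Λ] X), Function.Surjective p := by
  have hc := (Submodule.fg_iff_compact (⊤ : Submodule Λ X)).1 Module.Finite.fg_top
  obtain ⟨s, hs⟩ := CompleteLattice.IsCompactElement.exists_finset_of_le_iSup _ hc
    (fun f : V →ₗ[Λ] X => LinearMap.range f) h.ge
  refine ⟨s.card, powDesc fun i => (s.equivFin.symm i).1, ?_⟩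
  rw [← LinearMap.range_eq_top, eq_top_iff]
  refine hs.trans (iSup₂_le fun f hf => ?_)
  rintro _ ⟨v, rfl⟩
  refine ⟨Pi.single (s.equivFin ⟨f, hf⟩) v, ?_⟩
  rw [powDesc_single]
  simp

theorem exists_powDesc_factor [IsHomFinite Λ] [Module.Finite Λ V] [Module.Finite Λ X] :
    ∃ (n : ℕ) (p : (Fin n → V) →ₗ[Λ] X), ∀ g : V →ₗ[Λ] X, ∃ h : V →ₗ[Λ] (Fin n → V),
      p ∘ₗ h = g := by
  obtain ⟨n, f, hf⟩ := IsHomFinite.exists_family (Λ := Λ) V X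
  refine ⟨n, powDesc f, fun g => ?_⟩
  obtain ⟨b, hb⟩ := (hf g).2
  refine ⟨LinearMap.pi b, ?_⟩
  ext v
  simp [powDesc_apply, hb]

theorem exists_powLift_factor [IsHomFinite Λ] [Module.Finite Λ V] [Module.Finite Λ X] :
    ∃ (n : ℕ) (p : X →ₗ[Λ] (Fin n → V)), ∀ g : X →ₗ[Λ] V, ∃ h : (Fin n → V) →ₗ[Λ] V,
      h ∘ₗ p = g := by
  obtain ⟨n, f, hf⟩ := IsHomFinite.exists_family (Λ := Λ) X V
  refine ⟨n, LinearMap.pi f, fun g => ?_⟩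
  obtain ⟨a, ha⟩ := (hf g).1
  refine ⟨powDesc a, ?_⟩
  ext v
  simp [powDesc_apply, ha]

theorem exists_lift_of_powDesc_factor {n m : ℕ} (p : (Fin n → V) →ₗ[Λ] X)
    (hp : ∀ g : V →ₗ[Λ] X, ∃ h : V →ₗ[Λ] (Fin n → V), p ∘ₗ h = g)
    (g : (Fin m → V) →ₗ[Λ] X) : ∃ h : (Fin m → V) →ₗ[Λ] (Fin n → V), p ∘ₗ h = g := by
  choose h hh using hp
  refine ⟨powDesc fun i => h (g ∘ₗ LinearMap.single Λ (fun _ => V) i), ?_⟩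
  refine LinearMap.pi_ext fun i v => ?_
  rw [LinearMap.comp_apply, powDesc_single, ← LinearMap.comp_apply, hh]
  rfl

/-- If `f` kills the kernel of the surjection `g`, then `f` factors through `g`. -/
theorem exists_desc (g : X →ₗ[Λ] Y) (hg : Function.Surjective g) (f : X →ₗ[Λ] Z)
    (h : ∀ x, g x = 0 → f x = 0) : ∃ k : Y →ₗ[Λ] Z, k ∘ₗ g = f := by
  refine ⟨(LinearMap.ker g).liftQ f (fun x hx => h x hx) ∘ₗ
    (g.quotKerEquivOfSurjective hg).symm.toLinearMap, ?_⟩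
  ext x
  have : (g.quotKerEquivOfSurjective hg).symm (g x) = (LinearMap.ker g).mkQ x := by
    rw [LinearEquiv.symm_apply_eq]
    rfl
  simp only [LinearMap.comp_apply, LinearEquiv.coe_coe, this]
  exact Submodule.liftQ_apply _ _ _

end Preliminaries

section Closure

variable {Λ} {C T : Set (ModuleCat.{0} Λ)}
variable {V X Y Z : Type} [AddCommGroup V] [Module Λ V] [AddCommGroup X] [Module Λ X]
  [AddCommGroup Y] [Module Λ Y] [AddCommGroup Z] [Module Λ Z]

theorem IsoClosed.of_equiv (hC : IsoClosed Λ C) (e : X ≃ₗ[Λ] Y) (h : ModuleCat.of Λ X ∈ C) :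
    ModuleCat.of Λ Y ∈ C :=
  hC (M := ModuleCat.of Λ X) (N := ModuleCat.of Λ Y) ⟨e⟩ h

theorem ExtClosed.of_exact (hC : ExtClosed Λ C) (f : X →ₗ[Λ] Y) (g : Y →ₗ[Λ] Z)
    (hf : Function.Injective f) (hg : Function.Surjective g)
    (h : ∀ y, g y = 0 ↔ ∃ x, f x = y) (hX : ModuleCat.of Λ X ∈ C)
    (hZ : ModuleCat.of Λ Z ∈ C) : ModuleCat.of Λ Y ∈ C :=
  hC (A := ModuleCat.of Λ X) (M := ModuleCat.of Λ Y) (B := ModuleCat.of Λ Z) f g hf hg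
    (by ext y; exact (h y).symm) hX hZ

theorem ExtClosed.of_submodule (hC : ExtClosed Λ C) (N : Submodule Λ X)
    (hN : ModuleCat.of Λ N ∈ C) (hQ : ModuleCat.of Λ (X ⧸ N) ∈ C) : ModuleCat.of Λ X ∈ C :=
  hC.of_exact N.subtype N.mkQ N.injective_subtype N.mkQ_surjective (fun y => by simp) hN hQ

theorem ExtClosed.of_ker (hC : ExtClosed Λ C) (g : X →ₗ[Λ] Y) (hg : Function.Surjective g)
    (hK : ModuleCat.of Λ (LinearMap.ker g) ∈ C) (hY : ModuleCat.of Λ Y ∈ C) :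
    ModuleCat.of Λ X ∈ C :=
  hC.of_exact (LinearMap.ker g).subtype g (LinearMap.ker g).injective_subtype hg
    (fun y => by simp) hK hY

theorem ExtClosed.prod (hC : ExtClosed Λ C) (hX : ModuleCat.of Λ X ∈ C)
    (hY : ModuleCat.of Λ Y ∈ C) : ModuleCat.of Λ (X × Y) ∈ C :=
  hC.of_exact (LinearMap.inl Λ X Y) (LinearMap.snd Λ X Y) LinearMap.inl_injective
    LinearMap.snd_surjective
    (fun y => ⟨fun h => ⟨y.1, Prod.ext rfl h.symm⟩, by rintro ⟨x, rfl⟩; rfl⟩) hX hY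

theorem ExtClosed.pow (hC : ExtClosed Λ C) (hI : IsoClosed Λ C) (h0 : HasZeroObj Λ C)
    (hX : ModuleCat.of Λ X ∈ C) (n : ℕ) : ModuleCat.of Λ (Fin n → X) ∈ C := by
  induction n with
  | zero => exact h0 _ (inferInstanceAs (Subsingleton (Fin 0 → X)))
  | succ n ih => exact hI.of_equiv (Fin.consLinearEquiv Λ fun _ => X) (hC.prod hX ih)

theorem IsTorsionClass.finite (hT : IsTorsionClass Λ T) (hX : ModuleCat.of Λ X ∈ T) :
    Module.Finite Λ X :=
  hT.1 _ hX

theorem IsTorsionClass.isoClosed (hT : IsTorsionClass Λ T) : IsoClosed Λ T := hT.2.1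

theorem IsTorsionClass.hasZeroObj (hT : IsTorsionClass Λ T) : HasZeroObj Λ T := hT.2.2.1

theorem IsTorsionClass.extClosed (hT : IsTorsionClass Λ T) : ExtClosed Λ T := hT.2.2.2.2

theorem IsTorsionClass.of_surjective (hT : IsTorsionClass Λ T) (hX : ModuleCat.of Λ X ∈ T)
    (g : X →ₗ[Λ] Y) (hg : Function.Surjective g) : ModuleCat.of Λ Y ∈ T :=
  hT.2.2.2.1 (M := ModuleCat.of Λ X) (N := ModuleCat.of Λ Y) g hg hX

theorem IsTorsionClass.range (hT : IsTorsionClass Λ T) (hX : ModuleCat.of Λ X ∈ T)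
    (g : X →ₗ[Λ] Y) : ModuleCat.of Λ (LinearMap.range g) ∈ T :=
  hT.of_surjective hX g.rangeRestrict g.surjective_rangeRestrict

theorem IsTorsionClass.pow (hT : IsTorsionClass Λ T) (hX : ModuleCat.of Λ X ∈ T) (n : ℕ) :
    ModuleCat.of Λ (Fin n → X) ∈ T :=
  hT.extClosed.pow hT.isoClosed hT.hasZeroObj hX n

theorem IsTorsionClass.of_moduleTrace_eq_top (hT : IsTorsionClass Λ T)
    (hV : ModuleCat.of Λ V ∈ T) [Module.Finite Λ X] (h : moduleTrace Λ V X = ⊤) :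
    ModuleCat.of Λ X ∈ T := by
  obtain ⟨n, p, hp⟩ := exists_powDesc_surjective h
  exact hT.of_surjective (hT.pow hV n) p hp

theorem moduleTrace_moduleTrace : moduleTrace Λ V (moduleTrace Λ V X) = ⊤ := by
  have key : moduleTrace Λ V X ≤
      (moduleTrace Λ V (moduleTrace Λ V X)).map (moduleTrace Λ V X).subtype :=
    moduleTrace_le fun f v =>
      ⟨f.codRestrict _ (apply_mem_moduleTrace f) v, apply_mem_moduleTrace _ v, rfl⟩
  refine eq_top_iff.2 fun x _ => ?_
  obtain ⟨y, hy, hyx⟩ := key x.2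
  rwa [← Subtype.ext hyx]

theorem IsTorsionClass.moduleTrace_mem [IsNoetherianRing Λ] (hT : IsTorsionClass Λ T)
    (hV : ModuleCat.of Λ V ∈ T) [Module.Finite Λ X] :
    ModuleCat.of Λ (moduleTrace Λ V X) ∈ T :=
  hT.of_moduleTrace_eq_top hV moduleTrace_moduleTrace

/-- The torsion submodule of a finitely generated module. -/
theorem IsTorsionClass.exists_radical [IsNoetherianRing Λ] (hT : IsTorsionClass Λ T)
    (X : Type) [AddCommGroup X] [Module Λ X] [Module.Finite Λ X] :
    ∃ t : Submodule Λ X, ModuleCat.of Λ t ∈ T ∧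
      (∀ (A : ModuleCat.{0} Λ), A ∈ T → ∀ (f : A →ₗ[Λ] X) a, f a ∈ t) ∧
      ∀ (A : ModuleCat.{0} Λ), A ∈ T → ∀ f : A →ₗ[Λ] X ⧸ t, f = 0 := by
  obtain ⟨t, ht, hmax⟩ := set_has_maximal_iff_noetherian.2 (inferInstanceAs (IsNoetherian Λ X))
    {t : Submodule Λ X | ModuleCat.of Λ t ∈ T}
    ⟨⊥, hT.hasZeroObj _ (inferInstanceAs (Subsingleton (⊥ : Submodule Λ X)))⟩
  have hle : ∀ s : Submodule Λ X, ModuleCat.of Λ s ∈ T → s ≤ t := by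
    intro s hs
    have h := hT.range (hT.extClosed.prod hs ht) (LinearMap.coprod s.subtype t.subtype)
    have hr : LinearMap.range (LinearMap.coprod s.subtype t.subtype) = s ⊔ t := by
      rw [LinearMap.range_coprod, Submodule.range_subtype, Submodule.range_subtype]
    rw [hr] at h
    have := hmax _ h
    exact le_sup_left.trans (not_lt_iff_le_imp_ge.1 this le_sup_right)
  refine ⟨t, ht, fun A hA f a => hle _ (hT.range hA f) ⟨a, rfl⟩, fun A hA f => ?_⟩
  let N := (LinearMap.range f).comap t.mkQ
  have hN : ModuleCat.of Λ N ∈ T := by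
    refine hT.extClosed.of_exact
      (Submodule.inclusion (show t ≤ N from fun x hx => ?_))
      (t.mkQ.restrict (p := N) (q := LinearMap.range f) fun x hx => hx)
      (Submodule.inclusion_injective _) ?_ ?_ ht (hT.range hA f)
    · refine ⟨0, ?_⟩
      rw [map_zero]
      exact ((Submodule.Quotient.mk_eq_zero t).2 hx).symm
    · rintro ⟨y, hy⟩
      obtain ⟨x, rfl⟩ := t.mkQ_surjective y
      exact ⟨⟨x, hy⟩, rfl⟩
    · rintro ⟨y, hy⟩
      constructor
      · intro h
        have h' : t.mkQ y = 0 := congrArg Subtype.val h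
        exact ⟨⟨y, (Submodule.Quotient.mk_eq_zero t).1 h'⟩, rfl⟩
      · rintro ⟨x, hx⟩
        refine Subtype.ext ?_
        have : y = x := (congrArg Subtype.val hx).symm
        subst this
        exact (Submodule.Quotient.mk_eq_zero t).2 x.2
  ext a
  obtain ⟨x, hx⟩ := t.mkQ_surjective (f a)
  have : x ∈ t := hle N hN ⟨a, hx.symm⟩
  rw [← hx]
  exact (Submodule.Quotient.mk_eq_zero t).2 this

theorem IsTorsionClass.contravariantlyFinite [IsNoetherianRing Λ] (hT : IsTorsionClass Λ T) :
    ContravariantlyFinite Λ T := by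
  intro M hM
  obtain ⟨t, ht, h, -⟩ := hT.exists_radical M
  exact ⟨ModuleCat.of Λ t, ht, t.subtype, fun N hN g =>
    ⟨g.codRestrict t (h N hN g), LinearMap.ext fun _ => rfl⟩⟩

/-- A torsion class generated under quotients by one of its members is covariantly finite. -/
theorem IsTorsionClass.covariantlyFinite_of_generator [IsHomFinite Λ]
    (hT : IsTorsionClass Λ T) (hV : ModuleCat.of Λ V ∈ T)
    (h : ∀ A : ModuleCat.{0} Λ, A ∈ T → moduleTrace Λ V A = ⊤) : CovariantlyFinite Λ T := by
  intro N hN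
  have := hT.finite hV
  obtain ⟨k, q, hq⟩ := Module.Finite.exists_fin' Λ N
  obtain ⟨n, F, hF⟩ := exists_powLift_factor (Λ := Λ) (V := V) (X := Fin k → Λ)
  have single : ∀ (A : ModuleCat.{0} Λ) (x : A), x ∈ moduleTrace Λ V A → ∀ j : Fin k,
      ∃ u : (Fin n → V) →ₗ[Λ] A, u ∘ₗ F = LinearMap.toSpanSingleton Λ A x ∘ₗ LinearMap.proj j := by
    intro A x hx j
    refine Submodule.iSup_induction _ (motive := fun x : A => ∃ u : (Fin n → V) →ₗ[Λ] A,
      u ∘ₗ F = LinearMap.toSpanSingleton Λ A x ∘ₗ LinearMap.proj j) hx ?_ ?_ ?_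
    · rintro f _ ⟨v, rfl⟩
      obtain ⟨u, hu⟩ := hF (LinearMap.toSpanSingleton Λ V v ∘ₗ LinearMap.proj j)
      refine ⟨f ∘ₗ u, ?_⟩
      rw [LinearMap.comp_assoc, hu]
      ext a
      simp
    · exact ⟨0, by ext; simp⟩
    · rintro x y ⟨u, hu⟩ ⟨w, hw⟩
      exact ⟨u + w, by rw [LinearMap.add_comp, hu, hw]; ext; simp⟩
  have factor : ∀ A : ModuleCat.{0} Λ, A ∈ T → ∀ g : (Fin k → Λ) →ₗ[Λ] A,
      ∃ u : (Fin n → V) →ₗ[Λ] A, u ∘ₗ F = g := by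
    intro A hA g
    choose u hu using fun j => single A (g (Pi.single j 1)) (h A hA ▸ Submodule.mem_top) j
    refine ⟨∑ j, u j, ?_⟩
    refine LinearMap.ext fun a => ?_
    have hj : ∀ j, u j (F a) = a j • g (Pi.single j 1) := fun j => LinearMap.congr_fun (hu j) a
    rw [LinearMap.comp_apply, LinearMap.sum_apply, Finset.sum_congr rfl fun j _ => hj j]
    conv_rhs => rw [← Finset.univ_sum_single a, map_sum]
    refine Finset.sum_congr rfl fun j _ => ?_
    rw [← map_smul, ← Pi.single_smul, smul_eq_mul, mul_one]
  let R := (LinearMap.ker q).map F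
  obtain ⟨f, hf⟩ := exists_desc q hq (R.mkQ ∘ₗ F) fun x hx =>
    (Submodule.Quotient.mk_eq_zero R).2 ⟨x, hx, rfl⟩
  refine ⟨ModuleCat.of Λ ((Fin n → V) ⧸ R), hT.of_surjective (hT.pow hV n) R.mkQ R.mkQ_surjective,
    f, fun A hA g => ?_⟩
  obtain ⟨u, hu⟩ := factor A hA (g ∘ₗ q)
  have hR : R ≤ LinearMap.ker u := by
    rintro _ ⟨x, hx, rfl⟩
    have := LinearMap.congr_fun hu x
    rw [LinearMap.mem_ker]
    refine this.trans ?_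
    rw [LinearMap.comp_apply, LinearMap.mem_ker.1 hx, map_zero]
  refine ⟨R.liftQ u hR, ?_⟩
  refine LinearMap.ext fun y => ?_
  obtain ⟨x, rfl⟩ := hq y
  have h1 : f (q x) = R.mkQ (F x) := LinearMap.congr_fun hf x
  rw [LinearMap.comp_apply, h1]
  exact LinearMap.congr_fun hu x

end Closure

section MinimalGenerator

variable {Λ} {T : Set (ModuleCat.{0} Λ)}
variable {M X Y : Type} [AddCommGroup M] [Module Λ M] [AddCommGroup X] [Module Λ X]
  [AddCommGroup Y] [Module Λ Y]

/-- `Λ → M`, `1 ↦ m`, is a minimal left `T`-approximation of the regular module. -/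
structure IsMinimalGenerator (T : Set (ModuleCat.{0} Λ)) (M : Type) [AddCommGroup M]
    [Module Λ M] (m : M) : Prop where
  mem : ModuleCat.of Λ M ∈ T
  exists_map : ∀ A : ModuleCat.{0} Λ, A ∈ T → ∀ a : A, ∃ f : M →ₗ[Λ] A, f m = a
  bijective : ∀ φ : M →ₗ[Λ] M, φ m = m → Function.Bijective φ

/-- The modules `X` for which evaluation at `m` identifies `Hom(M, X)` with `X`. -/
def evalPerp {M : Type} [AddCommGroup M] [Module Λ M] (m : M) : Set (ModuleCat.{0} Λ) :=
  {X | FG Λ X ∧ (∀ x : X, ∃ f : M →ₗ[Λ] X, f m = x) ∧ ∀ f : M →ₗ[Λ] X, f m = 0 → f = 0}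

theorem IsTorsionClass.exists_isMinimalGenerator [IsArtinianRing Λ] (hT : IsTorsionClass Λ T)
    (hcov : CovariantlyFinite Λ T) :
    ∃ (M : ModuleCat.{0} Λ) (m : M), IsMinimalGenerator T M m := by
  let s : Set (ModuleCat.{0} Λ) :=
    {M | M ∈ T ∧ ∃ m : M, ∀ A : ModuleCat.{0} Λ, A ∈ T → ∀ a : A, ∃ f : M →ₗ[Λ] A, f m = a}
  have hs : s.Nonempty := by
    obtain ⟨N, hN, f, hf⟩ := hcov (ModuleCat.of Λ Λ) (inferInstanceAs (Module.Finite Λ Λ))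
    refine ⟨N, hN, f (1 : Λ), fun A hA a => ?_⟩
    obtain ⟨h, hh⟩ := hf A hA (LinearMap.toSpanSingleton Λ A a)
    refine ⟨h, (LinearMap.congr_fun hh (1 : Λ)).trans ?_⟩
    exact LinearMap.toSpanSingleton_apply_one ..
  obtain ⟨M, ⟨hM, m, hm⟩, hmin⟩ := WellFounded.has_min
    (InvImage.wf (fun M : ModuleCat.{0} Λ => Module.length Λ M) wellFounded_lt) s hs
  have : Module.Finite Λ M := hT.1 _ hM
  refine ⟨M, m, hM, hm, fun φ hφ => ?_⟩
  refine IsNoetherian.bijective_of_surjective_endomorphism φ ?_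
  rw [← LinearMap.range_eq_top]
  by_contra hne
  refine hmin (ModuleCat.of Λ (LinearMap.range φ)) ⟨hT.range hM φ, ⟨m, m, hφ⟩, fun A hA a => ?_⟩
    (Submodule.length_lt hne)
  obtain ⟨f, hf⟩ := hm A hA a
  exact ⟨f ∘ₗ (LinearMap.range φ).subtype, hf⟩

theorem evalPerp_finite {m : M} (hX : ModuleCat.of Λ X ∈ evalPerp m) : Module.Finite Λ X :=
  hX.1

variable {m : M}

theorem IsMinimalGenerator.moduleTrace_eq_top (hM : IsMinimalGenerator T M m)
    (hX : ModuleCat.of Λ X ∈ T) :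
    moduleTrace Λ M X = ⊤ := by
  refine eq_top_iff.2 fun x _ => ?_
  obtain ⟨f, rfl⟩ := hM.exists_map _ hX x
  exact apply_mem_moduleTrace f m

/-- `M` is `Ext`-projective in `T`. -/
theorem IsMinimalGenerator.exists_lift (hT : IsTorsionClass Λ T) (hM : IsMinimalGenerator T M m)
    (g : X →ₗ[Λ] Y) (hg : Function.Surjective g)
    (hK : ModuleCat.of Λ (LinearMap.ker g) ∈ T) (f : M →ₗ[Λ] Y) :
    ∃ k : M →ₗ[Λ] X, g ∘ₗ k = f := by
  let P : Submodule Λ (X × M) :=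
    LinearMap.ker (g ∘ₗ LinearMap.fst Λ X M - f ∘ₗ LinearMap.snd Λ X M)
  have hP' : ∀ z : X × M, z ∈ P ↔ g z.1 = f z.2 := fun z => by
    simp [P, sub_eq_zero]
  have hP : ModuleCat.of Λ P ∈ T := by
    refine hT.extClosed.of_exact
      ((LinearMap.inl Λ X M ∘ₗ (LinearMap.ker g).subtype).codRestrict P fun x => ?_)
      (LinearMap.snd Λ X M ∘ₗ P.subtype) ?_ ?_ ?_ hK hM.mem
    · rw [hP']
      simp
    · intro x y h
      exact Subtype.ext (congrArg Prod.fst (congrArg Subtype.val h))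
    · intro y
      obtain ⟨x, hx⟩ := hg (f y)
      exact ⟨⟨(x, y), (hP' _).2 hx⟩, rfl⟩
    · rintro ⟨⟨x, y⟩, hxy⟩
      rw [hP'] at hxy
      constructor
      · intro h
        have h : y = 0 := h
        subst h
        exact ⟨⟨x, by simpa using hxy⟩, rfl⟩
      · rintro ⟨z, hz⟩
        exact (congrArg Prod.snd (congrArg Subtype.val hz)).symm
  obtain ⟨x, hx⟩ := hg (f m)
  obtain ⟨ψ, hψ⟩ := hM.exists_map _ hP ⟨(x, m), (hP' _).2 hx⟩
  have hφ := hM.bijective (LinearMap.snd Λ X M ∘ₗ P.subtype ∘ₗ ψ)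
    (congrArg (fun z : P => z.1.2) hψ)
  let φ := LinearEquiv.ofBijective _ hφ
  refine ⟨LinearMap.fst Λ X M ∘ₗ P.subtype ∘ₗ ψ ∘ₗ φ.symm.toLinearMap, ?_⟩
  ext y
  obtain ⟨z, rfl⟩ := φ.surjective y
  have := (hP' _).1 (ψ z).2
  change g (ψ (φ.symm (φ z))).1.1 = f (ψ z).1.2
  rw [φ.symm_apply_apply]
  exact this

theorem IsMinimalGenerator.mem_of_mem_evalPerp (hT : IsTorsionClass Λ T) (hM : IsMinimalGenerator T M m)
    (hX : ModuleCat.of Λ X ∈ evalPerp m) :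
    ModuleCat.of Λ X ∈ T := by
  have := evalPerp_finite hX
  refine hT.of_moduleTrace_eq_top hM.mem (eq_top_iff.2 fun x _ => ?_)
  obtain ⟨f, rfl⟩ := hX.2.1 x
  exact apply_mem_moduleTrace f m

theorem IsMinimalGenerator.submodule_mem_evalPerp (hM : IsMinimalGenerator T M m)
    [IsNoetherianRing Λ]
    (hX : ModuleCat.of Λ X ∈ evalPerp m)
    (N : Submodule Λ X) (hN : ModuleCat.of Λ N ∈ T) : ModuleCat.of Λ N ∈ evalPerp m := by
  have := evalPerp_finite hX
  refine ⟨inferInstanceAs (Module.Finite Λ N), hM.exists_map _ hN, fun f hf => ?_⟩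
  have := hX.2.2 (N.subtype ∘ₗ f) (by
    rw [LinearMap.comp_apply]
    exact (congrArg N.subtype hf).trans (map_zero _))
  ext y
  exact LinearMap.congr_fun this y

theorem IsMinimalGenerator.isWide_evalPerp (hT : IsTorsionClass Λ T) (hM : IsMinimalGenerator T M m)
    [IsNoetherianRing Λ] : IsWide Λ (evalPerp m) := by
  refine ⟨fun A hA => hA.1, ?_, ?_, ?_, ?_, ?_⟩
  · rintro A B ⟨e⟩ hA
    have := hA.1
    refine ⟨Module.Finite.equiv e, fun x => ?_, fun f hf => ?_⟩
    · obtain ⟨f, hf⟩ := hA.2.1 (e.symm x)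
      exact ⟨e.toLinearMap ∘ₗ f, by simp [hf]⟩
    · have := hA.2.2 (e.symm.toLinearMap ∘ₗ f) (by simp [hf])
      ext y
      have := LinearMap.congr_fun this y
      simpa using this
  · intro A hA
    exact ⟨Module.Finite.of_finite, fun x => ⟨0, Subsingleton.elim _ _⟩,
      fun f _ => LinearMap.ext fun _ => Subsingleton.elim _ _⟩
  · intro A B f hA hB
    have := hA.1
    refine ⟨inferInstanceAs (Module.Finite Λ (LinearMap.ker f)), fun x => ?_, fun g hg => ?_⟩
    · obtain ⟨g, hg⟩ := hA.2.1 x.1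
      have hfg := hB.2.2 (f ∘ₗ g) (by rw [LinearMap.comp_apply, hg]; exact x.2)
      exact ⟨g.codRestrict _ fun y => LinearMap.congr_fun hfg y, Subtype.ext hg⟩
    · have := hA.2.2 ((LinearMap.ker f).subtype ∘ₗ g) (by
        rw [LinearMap.comp_apply]
        exact (congrArg (LinearMap.ker f).subtype hg).trans (map_zero _))
      ext y
      exact LinearMap.congr_fun this y
  · intro A B f hA hB
    have := hB.1
    have hI : ModuleCat.of Λ (LinearMap.range f) ∈ T :=
      hT.range (hM.mem_of_mem_evalPerp hT hA) f
    refine ⟨inferInstanceAs (Module.Finite Λ (B ⧸ LinearMap.range f)), fun x => ?_,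
      fun g hg => ?_⟩
    · obtain ⟨y, rfl⟩ := (LinearMap.range f).mkQ_surjective x
      obtain ⟨g, hg⟩ := hB.2.1 y
      exact ⟨(LinearMap.range f).mkQ ∘ₗ g, congrArg _ hg⟩
    · obtain ⟨k, hk⟩ := hM.exists_lift hT (LinearMap.range f).mkQ
        (LinearMap.range f).mkQ_surjective (by rw [Submodule.ker_mkQ]; exact hI) g
      have hkm : k m ∈ LinearMap.range f :=
        (Submodule.Quotient.mk_eq_zero _).1 ((LinearMap.congr_fun hk m).trans hg)
      obtain ⟨l, hl⟩ := hM.exists_map _ hI ⟨k m, hkm⟩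
      have hkl := hB.2.2 (k - (LinearMap.range f).subtype ∘ₗ l) (by
        rw [LinearMap.sub_apply, LinearMap.comp_apply]
        exact sub_eq_zero.2 (congrArg Subtype.val hl).symm)
      rw [← hk]
      refine LinearMap.ext fun y => ?_
      have : k y = l y := sub_eq_zero.1 (LinearMap.congr_fun hkl y)
      refine (Submodule.Quotient.mk_eq_zero _).2 ?_
      rw [this]
      exact (l y).2
  · intro A B C f g hf hg hfg hA hC
    have := hA.1
    have := hC.1
    have hB : FG Λ B := Module.Finite.of_exact (f := f) (g := g)
      (LinearMap.exact_iff.2 hfg.symm) hg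
    have hK : ModuleCat.of Λ (LinearMap.ker g) ∈ T := by
      rw [← hfg]
      exact hT.range (hM.mem_of_mem_evalPerp hT hA) f
    have hBT : B ∈ T := hT.extClosed.of_ker g hg hK (hM.mem_of_mem_evalPerp hT hC)
    refine ⟨hB, hM.exists_map _ hBT, fun k hk => ?_⟩
    have hgk := hC.2.2 (g ∘ₗ k) (by rw [LinearMap.comp_apply, hk, map_zero])
    have hr : ∀ y, k y ∈ LinearMap.range f := fun y => by
      rw [hfg]
      exact LinearMap.congr_fun hgk y
    let e := LinearEquiv.ofInjective f hf
    have hl := hA.2.2 (e.symm.toLinearMap ∘ₗ k.codRestrict _ hr) (by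
      rw [LinearMap.comp_apply]
      have : k.codRestrict _ hr m = 0 := Subtype.ext hk
      rw [this]
      exact map_zero _)
    ext y
    have h1 : e.symm (k.codRestrict _ hr y) = 0 := LinearMap.congr_fun hl y
    rw [LinearEquiv.map_eq_zero_iff] at h1
    exact congrArg Subtype.val h1

end MinimalGenerator

section EvalRadical

variable {Λ} {T : Set (ModuleCat.{0} Λ)}
variable {M X Y Z : Type} [AddCommGroup M] [Module Λ M] [AddCommGroup X] [Module Λ X]
  [AddCommGroup Y] [Module Λ Y] [AddCommGroup Z] [Module Λ Z]

variable (Λ) in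
/-- The trace of `M / Λm` in `X`. -/
abbrev evalRadical {M : Type} [AddCommGroup M] [Module Λ M] (m : M) (X : Type) [AddCommGroup X] [Module Λ X] : Submodule Λ X :=
  moduleTrace Λ (M ⧸ Submodule.span Λ {m}) X

variable {m : M}

theorem apply_mem_evalRadical (h : M →ₗ[Λ] X) (hm : h m = 0) (a : M) :
    h a ∈ evalRadical Λ m X :=
  apply_mem_moduleTrace ((Submodule.span Λ {m}).liftQ h ((Submodule.span_singleton_le_iff_mem _ _).2
    hm)) ((Submodule.span Λ {m}).mkQ a)

theorem evalRadical_le_ker (hZ : ModuleCat.of Λ Z ∈ evalPerp m) (f : X →ₗ[Λ] Z) :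
    evalRadical Λ m X ≤ LinearMap.ker f := by
  refine moduleTrace_le fun g v => ?_
  obtain ⟨a, rfl⟩ := (Submodule.span Λ {m}).mkQ_surjective v
  refine LinearMap.congr_fun (hZ.2.2 (f ∘ₗ g ∘ₗ (Submodule.span Λ {m}).mkQ) ?_) a
  have : (Submodule.span Λ {m}).mkQ m = 0 :=
    (Submodule.Quotient.mk_eq_zero _).2 (Submodule.mem_span_singleton_self m)
  rw [LinearMap.comp_apply, LinearMap.comp_apply, this, map_zero]
  exact map_zero f

variable [IsNoetherianRing Λ]

theorem IsMinimalGenerator.evalRadical_mem (hT : IsTorsionClass Λ T) (hM : IsMinimalGenerator T M m)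
    [Module.Finite Λ X] :
    ModuleCat.of Λ (evalRadical Λ m X) ∈ T :=
  hT.moduleTrace_mem (hT.of_surjective hM.mem _ (Submodule.span Λ {m}).mkQ_surjective)

theorem IsMinimalGenerator.quotient_mem_evalPerp (hT : IsTorsionClass Λ T) (hM : IsMinimalGenerator T M m)
    (hX : ModuleCat.of Λ X ∈ T) :
    ModuleCat.of Λ (X ⧸ evalRadical Λ m X) ∈ evalPerp m := by
  have := hT.finite hX
  have hR := hM.evalRadical_mem hT (X := X)
  refine ⟨inferInstanceAs (Module.Finite Λ (X ⧸ evalRadical Λ m X)), hM.exists_map _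
    (hT.of_surjective hX _ (evalRadical Λ m X).mkQ_surjective), fun g hg => ?_⟩
  obtain ⟨k, hk⟩ := hM.exists_lift hT _ (evalRadical Λ m X).mkQ_surjective
    (by rwa [Submodule.ker_mkQ]) g
  have hkm : k m ∈ evalRadical Λ m X :=
    (Submodule.Quotient.mk_eq_zero _).1 ((LinearMap.congr_fun hk m).trans hg)
  obtain ⟨l, hl⟩ := hM.exists_map _ hR ⟨k m, hkm⟩
  rw [← hk]
  refine LinearMap.ext fun y => (Submodule.Quotient.mk_eq_zero _).2 ?_
  have h1 := apply_mem_evalRadical (k - (evalRadical Λ m X).subtype ∘ₗ l) (by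
    rw [LinearMap.sub_apply, LinearMap.comp_apply]
    exact sub_eq_zero.2 (congrArg Subtype.val hl).symm) y
  have h2 := add_mem h1 (l y).2
  rwa [LinearMap.sub_apply, LinearMap.comp_apply, Submodule.coe_subtype, sub_add_cancel] at h2

theorem IsMinimalGenerator.ker_mem (hT : IsTorsionClass Λ T) (hM : IsMinimalGenerator T M m)
    (hX : ModuleCat.of Λ X ∈ T)
    (hZ : ModuleCat.of Λ Z ∈ evalPerp m) (f : X →ₗ[Λ] Z) :
    ModuleCat.of Λ (LinearMap.ker f) ∈ T := by
  have := hT.finite hX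
  have hle : evalRadical Λ m X ≤ LinearMap.ker f := evalRadical_le_ker hZ f
  let f' : (X ⧸ evalRadical Λ m X) →ₗ[Λ] Z := (evalRadical Λ m X).liftQ f hle
  have hK : ModuleCat.of Λ (LinearMap.ker f') ∈ T :=
    hM.mem_of_mem_evalPerp hT ((hM.isWide_evalPerp hT).2.2.2.1
      (M := ModuleCat.of Λ (X ⧸ evalRadical Λ m X)) (N := ModuleCat.of Λ Z) f'
      (hM.quotient_mem_evalPerp hT hX) hZ)
  refine hT.extClosed.of_exact (Submodule.inclusion hle)
    ((evalRadical Λ m X).mkQ.restrict (p := LinearMap.ker f) (q := LinearMap.ker f') fun x hx => hx)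
    (Submodule.inclusion_injective _) ?_ ?_ (hM.evalRadical_mem hT) hK
  · rintro ⟨y, hy⟩
    obtain ⟨x, rfl⟩ := (evalRadical Λ m X).mkQ_surjective y
    exact ⟨⟨x, hy⟩, rfl⟩
  · rintro ⟨y, hy⟩
    constructor
    · intro h
      have h' : (evalRadical Λ m X).mkQ y = 0 := congrArg Subtype.val h
      exact ⟨⟨y, (Submodule.Quotient.mk_eq_zero _).1 h'⟩, rfl⟩
    · rintro ⟨x, hx⟩
      obtain rfl : y = x := (congrArg Subtype.val hx).symm
      exact Subtype.ext ((Submodule.Quotient.mk_eq_zero _).2 x.2)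

end EvalRadical

section TorsClosure

theorem isTorsionClass_finite : IsTorsionClass Λ {M | FG Λ M} := by
  refine ⟨fun _ h => h, ?_, ?_, ?_, ?_⟩
  · rintro A B ⟨e⟩ (hA : Module.Finite Λ A)
    exact Module.Finite.equiv e
  · intro A hA
    exact (Module.Finite.of_finite : Module.Finite Λ A)
  · intro A B g hg (hA : Module.Finite Λ A)
    exact Module.Finite.of_surjective g hg
  · intro A B C f g hf hg hfg (hA : Module.Finite Λ A) (hC : Module.Finite Λ C)
    exact Module.Finite.of_exact (f := f) (g := g) (LinearMap.exact_iff.2 hfg.symm) hg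

theorem isTorsionClass_lPerp (F : Set (ModuleCat.{0} Λ)) : IsTorsionClass Λ (lPerp Λ F) := by
  have h := isTorsionClass_finite Λ
  refine ⟨fun _ h => h.1, ?_, ?_, ?_, ?_⟩
  · rintro A B ⟨e⟩ hA
    refine ⟨h.2.1 ⟨e⟩ hA.1, fun Y hY f => ?_⟩
    ext y
    simpa using LinearMap.congr_fun (hA.2 Y hY (f ∘ₗ e.toLinearMap)) (e.symm y)
  · intro A hA
    exact ⟨h.2.2.1 A hA, fun Y hY f => LinearMap.ext fun a => by
      rw [Subsingleton.elim a 0, map_zero, map_zero]⟩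
  · intro A B g hg hA
    refine ⟨h.2.2.2.1 g hg hA.1, fun Y hY f => ?_⟩
    ext y
    obtain ⟨x, rfl⟩ := hg y
    exact LinearMap.congr_fun (hA.2 Y hY (f ∘ₗ g)) x
  · intro A B C f g hf hg hfg hA hC
    refine ⟨h.2.2.2.2 f g hf hg hfg hA.1 hC.1, fun Y hY u => ?_⟩
    obtain ⟨k, rfl⟩ := exists_desc g hg u fun x hx => by
      obtain ⟨a, rfl⟩ : x ∈ LinearMap.range f := by rw [hfg]; exact hx
      exact LinearMap.congr_fun (hA.2 Y hY (u ∘ₗ f)) a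
    rw [hC.2 Y hY k, LinearMap.zero_comp]

variable {Λ}

theorem isTorsionClass_torsClosure {S : Set (ModuleCat.{0} Λ)} (hS : ∀ M ∈ S, FG Λ M) :
    IsTorsionClass Λ (torsClosure Λ S) := by
  refine ⟨fun A hA => hA _ ⟨isTorsionClass_finite Λ, hS⟩, ?_, ?_, ?_, ?_⟩
  · intro A B e hA C hC
    exact hC.1.2.1 e (hA C hC)
  · intro A hA C hC
    exact hC.1.2.2.1 A hA
  · intro A B g hg hA C hC
    exact hC.1.2.2.2.1 g hg (hA C hC)
  · intro A B D f g hf hg hfg hA hD C hC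
    exact hC.1.2.2.2.2 f g hf hg hfg (hA C hC) (hD C hC)

theorem subset_torsClosure (S : Set (ModuleCat.{0} Λ)) : S ⊆ torsClosure Λ S :=
  fun _ hA _ hC => hC.2 hA

theorem torsClosure_subset {S T : Set (ModuleCat.{0} Λ)} (hT : IsTorsionClass Λ T) (h : S ⊆ T) :
    torsClosure Λ S ⊆ T :=
  fun _ hA => hA T ⟨hT, h⟩

end TorsClosure

section EvalPerpGenerates

variable {Λ} {T : Set (ModuleCat.{0} Λ)} {M : Type} [AddCommGroup M] [Module Λ M] {m : M}

theorem IsMinimalGenerator.mem_jacobson (hM : IsMinimalGenerator T M m) (h : Module.End Λ M)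
    (hm : h m = 0) : h ∈ Ring.jacobson (Module.End Λ M) := by
  rw [Ring.jacobson_eq_sInf_isMaximal, Ideal.mem_sInf]
  intro I hI
  by_contra hh
  obtain ⟨b, x, hx, hbx⟩ := hI.exists_inv hh
  have hxm : x m = m := by
    have := LinearMap.congr_fun hbx m
    rwa [LinearMap.add_apply, Module.End.mul_apply, hm, map_zero, zero_add] at this
  have hu : IsUnit x := (Module.End.isUnit_iff x).2 (hM.bijective x hxm)
  exact hI.ne_top (Ideal.eq_top_of_isUnit_mem I hx hu)

theorem IsMinimalGenerator.torsClosure_evalPerp [IsNoetherianRing Λ] [IsHomFinite Λ]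
    (hT : IsTorsionClass Λ T) (hM : IsMinimalGenerator T M m) :
    torsClosure Λ (evalPerp m) = T := by
  have hWT : evalPerp m ⊆ T := fun A hA => hM.mem_of_mem_evalPerp hT hA
  refine (torsClosure_subset hT hWT).antisymm fun X hX => ?_
  have hT₀ := isTorsionClass_torsClosure (S := (evalPerp m : Set (ModuleCat.{0} Λ))) fun A hA => hA.1
  have := hT.1 X hX
  have := hT.finite hM.mem
  obtain ⟨t, ht, -, h0⟩ := hT₀.exists_radical X
  have hY : ModuleCat.of Λ (X ⧸ t) ∈ T := hT.of_surjective hX _ t.mkQ_surjective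
  have := IsHomFinite.isArtinianRing_end (Λ := Λ) M
  have key : ∀ v : M →ₗ[Λ] X ⧸ t, v ≠ 0 →
      ∃ h ∈ Ring.jacobson (Module.End Λ M), v ∘ₗ h ≠ 0 := by
    intro v hv
    by_contra! hJ
    obtain ⟨k, hk⟩ := exists_desc (evalRadical Λ m M).mkQ
      (evalRadical Λ m M).mkQ_surjective v fun x hx => by
        have hx : x ∈ evalRadical Λ m M := (Submodule.Quotient.mk_eq_zero _).1 hx
        refine (moduleTrace_le (p := LinearMap.ker v) fun f y => ?_) hx
        obtain ⟨a, rfl⟩ := (Submodule.span Λ {m}).mkQ_surjective y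
        refine LinearMap.congr_fun (hJ (f ∘ₗ (Submodule.span Λ {m}).mkQ : M →ₗ[Λ] M)
          (hM.mem_jacobson _ ?_)) a
        have : (Submodule.span Λ {m}).mkQ m = 0 :=
          (Submodule.Quotient.mk_eq_zero _).2 (Submodule.mem_span_singleton_self m)
        rw [LinearMap.comp_apply, this, map_zero]
    apply hv
    rw [← hk, h0 _ (subset_torsClosure _ (hM.quotient_mem_evalPerp hT hM.mem)) k,
      LinearMap.zero_comp]
  have hzero : ∀ v : M →ₗ[Λ] X ⧸ t, v = 0 := by
    intro v
    by_contra hv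
    have hk : ∀ k : ℕ, ∃ e ∈ Ring.jacobson (Module.End Λ M) ^ k, v ∘ₗ e ≠ 0 := by
      intro k
      induction k with
      | zero => exact ⟨1, by rw [Submodule.pow_zero, Ideal.one_eq_top]; trivial, hv⟩
      | succ k ih =>
        obtain ⟨e, he, hve⟩ := ih
        obtain ⟨h, hh, hveh⟩ := key _ hve
        exact ⟨e * h, by rw [Submodule.pow_succ]; exact Ideal.mul_mem_mul he hh, hveh⟩
    obtain ⟨n, hn⟩ := IsSemiprimaryRing.isNilpotent (R := Module.End Λ M)
    obtain ⟨e, he, hve⟩ := hk n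
    rw [hn] at he
    apply hve
    rw [show e = 0 from he, LinearMap.comp_zero]
  have htop : t = ⊤ := by
    refine eq_top_iff.2 fun x _ => ?_
    obtain ⟨f, hf⟩ := hM.exists_map _ hY (t.mkQ x)
    rw [hzero f] at hf
    exact (Submodule.Quotient.mk_eq_zero t).1 hf.symm
  subst htop
  exact hT₀.isoClosed.of_equiv Submodule.topEquiv ht

end EvalPerpGenerates

section EvalPerpFunctoriallyFinite

variable {Λ} {T : Set (ModuleCat.{0} Λ)} {M : Type} [AddCommGroup M] [Module Λ M] {m : M}

theorem IsMinimalGenerator.covariantlyFinite_evalPerp [IsNoetherianRing Λ]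
    (hT : IsTorsionClass Λ T) (hM : IsMinimalGenerator T M m) (hcov : CovariantlyFinite Λ T) :
    CovariantlyFinite Λ (evalPerp m) := by
  intro N hN
  obtain ⟨A, hA, f, hf⟩ := hcov N hN
  refine ⟨ModuleCat.of Λ (A ⧸ evalRadical Λ m A), hM.quotient_mem_evalPerp hT hA,
    (evalRadical Λ m A).mkQ ∘ₗ f, fun B hB g => ?_⟩
  obtain ⟨h, rfl⟩ := hf B (hM.mem_of_mem_evalPerp hT hB) g
  exact ⟨(evalRadical Λ m A).liftQ h (evalRadical_le_ker hB h), rfl⟩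

theorem IsMinimalGenerator.contravariantlyFinite_evalPerp [IsNoetherianRing Λ] [IsHomFinite Λ]
    (hT : IsTorsionClass Λ T) (hM : IsMinimalGenerator T M m) :
    ContravariantlyFinite Λ (evalPerp m) := by
  intro X hX
  have hW := hM.isWide_evalPerp hT
  let G := M ⧸ evalRadical Λ m M
  have hG : ModuleCat.of Λ G ∈ evalPerp m := hM.quotient_mem_evalPerp hT hM.mem
  have : Module.Finite Λ G := hG.1
  have hpow : ∀ n : ℕ, ModuleCat.of Λ (Fin n → G) ∈ evalPerp m := fun n =>
    hW.2.2.2.2.2.pow hW.2.1 hW.2.2.1 hG n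
  have htr : ∀ Y : ModuleCat.{0} Λ, Y ∈ evalPerp m → moduleTrace Λ G Y = ⊤ := by
    intro Y hY
    refine eq_top_iff.2 fun y _ => ?_
    obtain ⟨f, rfl⟩ := hY.2.1 y
    exact apply_mem_moduleTrace ((evalRadical Λ m M).liftQ f (evalRadical_le_ker hY f))
      ((evalRadical Λ m M).mkQ m)
  obtain ⟨k, p, hp⟩ := exists_powDesc_factor (Λ := Λ) (V := G) (X := X)
  obtain ⟨l, F, hF⟩ := exists_powDesc_factor (Λ := Λ) (V := G) (X := LinearMap.ker p)
  let c : (Fin l → G) →ₗ[Λ] (Fin k → G) := (LinearMap.ker p).subtype ∘ₗ F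
  have hc : LinearMap.range c ≤ LinearMap.ker p := by
    rintro _ ⟨x, rfl⟩
    exact (F x).2
  refine ⟨ModuleCat.of Λ ((Fin k → G) ⧸ LinearMap.range c), hW.2.2.2.2.1
    (M := ModuleCat.of Λ (Fin l → G)) (N := ModuleCat.of Λ (Fin k → G)) c (hpow l) (hpow k),
    (LinearMap.range c).liftQ p hc, fun Y hY g => ?_⟩
  have := hY.1
  obtain ⟨n, s, hs⟩ := exists_powDesc_surjective (htr Y hY)
  obtain ⟨h, hh⟩ := exists_lift_of_powDesc_factor p hp (g ∘ₗ s)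
  obtain ⟨u, hu⟩ := exists_desc s hs ((LinearMap.range c).mkQ ∘ₗ h) fun x hx => by
    have hL : ModuleCat.of Λ (LinearMap.ker s) ∈ evalPerp m :=
      hW.2.2.2.1 (M := ModuleCat.of Λ (Fin n → G)) (N := Y) s (hpow n) hY
    have hle : moduleTrace Λ G (LinearMap.ker s) ≤
        LinearMap.ker ((LinearMap.range c).mkQ ∘ₗ h ∘ₗ (LinearMap.ker s).subtype) := by
      refine moduleTrace_le fun a v => (Submodule.Quotient.mk_eq_zero _).2 ?_
      obtain ⟨b, hb⟩ := hF ((h ∘ₗ (LinearMap.ker s).subtype ∘ₗ a).codRestrict _ fun w => by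
        refine (LinearMap.congr_fun hh (a w)).trans ?_
        rw [LinearMap.comp_apply, show s (a w) = 0 from (a w).2, map_zero])
      exact ⟨b v, congrArg Subtype.val (LinearMap.congr_fun hb v)⟩
    rw [htr _ hL] at hle
    exact hle (Submodule.mem_top (x := (⟨x, hx⟩ : LinearMap.ker s)))
  refine ⟨u, LinearMap.ext fun y => ?_⟩
  obtain ⟨x, rfl⟩ := hs y
  exact (congrArg ((LinearMap.range c).liftQ p hc) (LinearMap.congr_fun hu x)).trans
    (LinearMap.congr_fun hh x)

/-- Every functorially finite torsion class is generated by a functorially finite wide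
subcategory. -/
theorem IsTorsionClass.exists_isWide_torsClosure_eq [IsArtinianRing Λ] [IsHomFinite Λ]
    (hT : IsTorsionClass Λ T) (hff : FunctoriallyFinite Λ T) :
    ∃ W, (IsWide Λ W ∧ FunctoriallyFinite Λ W ∧ FunctoriallyFinite Λ (torsClosure Λ W)) ∧
      torsClosure Λ W = T := by
  obtain ⟨M, m, hM⟩ := hT.exists_isMinimalGenerator hff.1
  have h := hM.torsClosure_evalPerp hT
  exact ⟨evalPerp m, ⟨hM.isWide_evalPerp hT, ⟨hM.covariantlyFinite_evalPerp hT hff.1,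
    hM.contravariantlyFinite_evalPerp hT⟩, h.symm ▸ hff⟩, h⟩

end EvalPerpFunctoriallyFinite

section Retract

variable {Λ} {T : Set (ModuleCat.{0} Λ)}
variable {M P Q V X Y Z : Type} [AddCommGroup M] [Module Λ M] [AddCommGroup P] [Module Λ P]
  [AddCommGroup Q] [Module Λ Q] [AddCommGroup V] [Module Λ V] [AddCommGroup X] [Module Λ X]
  [AddCommGroup Y] [Module Λ Y] [AddCommGroup Z] [Module Λ Z] {m : M}

variable (Λ) in
/-- `P` is a direct summand of a finite power of `M`. -/
def IsRetractOfPow (M P : Type) [AddCommGroup M] [Module Λ M] [AddCommGroup P] [Module Λ P] :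
    Prop :=
  ∃ (n : ℕ) (i : P →ₗ[Λ] (Fin n → M)) (r : (Fin n → M) →ₗ[Λ] P), r ∘ₗ i = LinearMap.id

theorem isRetractOfPow_pow (n : ℕ) : IsRetractOfPow Λ M (Fin n → M) :=
  ⟨n, LinearMap.id, LinearMap.id, rfl⟩

theorem IsRetractOfPow.of_retract (hP : IsRetractOfPow Λ M P) (i : Q →ₗ[Λ] P) (r : P →ₗ[Λ] Q)
    (h : ∀ x, r (i x) = x) : IsRetractOfPow Λ M Q := by
  obtain ⟨n, j, s, hs⟩ := hP
  refine ⟨n, j ∘ₗ i, r ∘ₗ s, LinearMap.ext fun x => ?_⟩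
  exact (congrArg r (LinearMap.congr_fun hs (i x))).trans (h x)

theorem IsRetractOfPow.prod (hP : IsRetractOfPow Λ M P) (hQ : IsRetractOfPow Λ M Q) :
    IsRetractOfPow Λ M (P × Q) := by
  obtain ⟨a, i, r, h⟩ := hP
  obtain ⟨b, j, s, h'⟩ := hQ
  let e : (Fin (a + b) → M) ≃ₗ[Λ] (Fin a → M) × (Fin b → M) :=
    (LinearEquiv.funCongrLeft Λ M finSumFinEquiv).trans
      (LinearEquiv.sumArrowLequivProdArrow (Fin a) (Fin b) Λ M)
  refine ⟨a + b, e.symm.toLinearMap ∘ₗ i.prodMap j, r.prodMap s ∘ₗ e.toLinearMap,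
    LinearMap.ext fun x => ?_⟩
  change r.prodMap s (e (e.symm (i.prodMap j x))) = x
  rw [e.apply_symm_apply]
  exact Prod.ext (LinearMap.congr_fun h x.1) (LinearMap.congr_fun h' x.2)

theorem IsRetractOfPow.mem (hP : IsRetractOfPow Λ M P) (hT : IsTorsionClass Λ T)
    (hM : ModuleCat.of Λ M ∈ T) : ModuleCat.of Λ P ∈ T := by
  obtain ⟨n, i, r, h⟩ := hP
  exact hT.of_surjective (hT.pow hM n) r fun x => ⟨i x, LinearMap.congr_fun h x⟩

theorem IsRetractOfPow.moduleTrace_eq_top (hP : IsRetractOfPow Λ M P)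
    (h : moduleTrace Λ P M ≤ moduleTrace Λ V M) : moduleTrace Λ V P = ⊤ := by
  obtain ⟨n, i, r, hr⟩ := hP
  refine eq_top_iff.2 fun x _ => ?_
  have hx : r (i x) = x := LinearMap.congr_fun hr x
  rw [← hx, ← Finset.univ_sum_single (i x), map_sum]
  exact Submodule.sum_mem _ fun j _ =>
    moduleTrace_le_comap (r ∘ₗ LinearMap.single Λ (fun _ => M) j)
      (h (apply_mem_moduleTrace (LinearMap.proj j ∘ₗ i) x))

theorem IsRetractOfPow.exists_lift (hP : IsRetractOfPow Λ M P) (hT : IsTorsionClass Λ T)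
    (hM : IsMinimalGenerator T M m) (g : X →ₗ[Λ] Z) (hg : Function.Surjective g)
    (hK : ModuleCat.of Λ (LinearMap.ker g) ∈ T) (f : P →ₗ[Λ] Z) :
    ∃ k : P →ₗ[Λ] X, g ∘ₗ k = f := by
  obtain ⟨n, i, r, hr⟩ := hP
  choose l hl using hM.exists_lift hT g hg hK
  have h : g ∘ₗ powDesc (fun j => l (f ∘ₗ r ∘ₗ LinearMap.single Λ (fun _ => M) j)) = f ∘ₗ r := by
    refine LinearMap.pi_ext fun j v => ?_
    rw [LinearMap.comp_apply, powDesc_single, ← LinearMap.comp_apply, hl]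
    rfl
  refine ⟨powDesc (fun j => l (f ∘ₗ r ∘ₗ LinearMap.single Λ (fun _ => M) j)) ∘ₗ i, ?_⟩
  rw [← LinearMap.comp_assoc, h, LinearMap.comp_assoc, hr, LinearMap.comp_id]

variable [IsNoetherianRing Λ]

theorem IsMinimalGenerator.eq_zero_or_surjective (hM : IsMinimalGenerator T M m)
    (hY : ModuleCat.of Λ Y ∈ evalPerp m)
    (hs : ∀ N : Submodule Λ Y, ModuleCat.of Λ N ∈ evalPerp m → N = ⊥ ∨ N = ⊤)
    (hT : IsTorsionClass Λ T) (hX : ModuleCat.of Λ X ∈ T) (f : X →ₗ[Λ] Y) :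
    f = 0 ∨ Function.Surjective f :=
  (hs _ (hM.submodule_mem_evalPerp hY _ (hT.range hX f))).imp LinearMap.range_eq_bot.1
    LinearMap.range_eq_top.1

theorem IsMinimalGenerator.exists_isRetractOfPow (hT : IsTorsionClass Λ T) (hM : IsMinimalGenerator T M m)
    [IsArtinianRing Λ]
    (hY : ModuleCat.of Λ Y ∈ evalPerp m)
    (hs : ∀ N : Submodule Λ Y, ModuleCat.of Λ N ∈ evalPerp m → N = ⊥ ∨ N = ⊤)
    (hX : ModuleCat.of Λ X ∈ evalPerp m) (hXY : ∀ f : X →ₗ[Λ] Y, f = 0) :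
    ∃ P : ModuleCat.{0} Λ, IsRetractOfPow Λ M P ∧ (∃ p : P →ₗ[Λ] X, Function.Surjective p) ∧
      ∀ f : P →ₗ[Λ] Y, f = 0 := by
  have := evalPerp_finite hX
  have hW := hM.isWide_evalPerp hT
  obtain ⟨P, ⟨hP, p, hp⟩, hmin⟩ := WellFounded.has_min
    (InvImage.wf (fun P : ModuleCat.{0} Λ => Module.length Λ P) wellFounded_lt)
    {P : ModuleCat.{0} Λ | IsRetractOfPow Λ M P ∧ ∃ p : P →ₗ[Λ] X, Function.Surjective p} (by
      obtain ⟨n, p, hp⟩ := exists_powDesc_surjective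
        (hM.moduleTrace_eq_top (hM.mem_of_mem_evalPerp hT hX))
      exact ⟨ModuleCat.of Λ (Fin n → M), isRetractOfPow_pow n, p, hp⟩)
  have hPT : P ∈ T := hP.mem hT hM.mem
  have := hT.1 P hPT
  refine ⟨P, hP, ⟨p, hp⟩, fun u => ?_⟩
  by_contra hu
  have hXY' : ModuleCat.of Λ (X × Y) ∈ evalPerp m := hW.2.2.2.2.2.prod hX hY
  have hI : ModuleCat.of Λ (LinearMap.range (p.prod u)) ∈ evalPerp m :=
    hM.submodule_mem_evalPerp hXY' _ (hT.range hPT _)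
  let π : LinearMap.range (p.prod u) →ₗ[Λ] X :=
    LinearMap.fst Λ X Y ∘ₗ (LinearMap.range (p.prod u)).subtype
  have hK : ModuleCat.of Λ (LinearMap.ker π) ∈ T := hM.mem_of_mem_evalPerp hT
    (hW.2.2.2.1 (M := ModuleCat.of Λ (LinearMap.range (p.prod u))) (N := ModuleCat.of Λ X) π hI hX)
  rcases hM.eq_zero_or_surjective hY hs hT hK (LinearMap.snd Λ X Y ∘ₗ
    (LinearMap.range (p.prod u)).subtype ∘ₗ (LinearMap.ker π).subtype) with h | h
  · obtain ⟨k, rfl⟩ := exists_desc p hp u fun x hx =>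
      LinearMap.congr_fun h ⟨⟨p.prod u x, x, rfl⟩, hx⟩
    rw [hXY k, LinearMap.zero_comp] at hu
    exact hu rfl
  have hsurj : ∀ y, ∃ x, p x = 0 ∧ u x = y := by
    intro y
    obtain ⟨⟨⟨_, x, rfl⟩, hx⟩, rfl⟩ := h y
    exact ⟨x, hx, rfl⟩
  let g : LinearMap.ker u →ₗ[Λ] X := p ∘ₗ (LinearMap.ker u).subtype
  have hg : Function.Surjective g := by
    intro x
    obtain ⟨a, rfl⟩ := hp x
    obtain ⟨b, hb, hub⟩ := hsurj (u a)
    refine ⟨⟨a - b, ?_⟩, ?_⟩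
    · rw [LinearMap.mem_ker, map_sub, hub, sub_self]
    · change p (a - b) = p a
      rw [map_sub, hb, sub_zero]
  have hgK : ModuleCat.of Λ (LinearMap.ker g) ∈ T := by
    refine hT.of_surjective (hM.ker_mem hT hPT hXY' (p.prod u))
      (((LinearMap.ker (p.prod u)).subtype.codRestrict (LinearMap.ker u) fun x =>
        congrArg Prod.snd x.2).codRestrict (LinearMap.ker g) fun x => congrArg Prod.fst x.2) ?_
    rintro ⟨⟨x, hx⟩, hx'⟩
    exact ⟨⟨x, Prod.ext hx' hx⟩, rfl⟩
  obtain ⟨ψ, hψ⟩ := hP.exists_lift hT hM g hg hgK p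
  let φ : Module.End Λ P := (LinearMap.ker u).subtype ∘ₗ ψ
  have hpφ : ∀ (n : ℕ) (x : P), p ((φ ^ n) x) = p x := by
    intro n
    induction n with
    | zero => exact fun x => rfl
    | succ n ih =>
      intro x
      rw [pow_succ, Module.End.mul_apply, ih]
      exact LinearMap.congr_fun hψ x
  obtain ⟨n, hn, hn1⟩ := ((LinearMap.eventually_isCompl_ker_pow_range_pow φ).and
    (Filter.eventually_ge_atTop 1)).exists
  refine hmin (ModuleCat.of Λ (LinearMap.range (φ ^ n)))
    ⟨hP.of_retract (LinearMap.range (φ ^ n)).subtype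
      ((LinearMap.range (φ ^ n)).projectionOnto _ hn.symm) fun x => ?_,
      p ∘ₗ (LinearMap.range (φ ^ n)).subtype, fun x => ?_⟩ (Submodule.length_lt fun htop => ?_)
  · exact Submodule.projectionOnto_apply_left hn.symm x
  · obtain ⟨a, rfl⟩ := hp x
    exact ⟨⟨(φ ^ n) a, a, rfl⟩, hpφ n a⟩
  · apply hu
    ext x
    obtain ⟨a, rfl⟩ := LinearMap.range_eq_top.1 htop x
    obtain ⟨n, rfl⟩ := Nat.exists_eq_add_of_le' hn1
    rw [pow_succ', Module.End.mul_apply]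
    exact (ψ _).2

end Retract

section Mutation

variable {Λ} {S T : Set (ModuleCat.{0} Λ)}

theorem IsTorsionClass.inter (hS : IsTorsionClass Λ S) (hT : IsTorsionClass Λ T) :
    IsTorsionClass Λ (S ∩ T) :=
  ⟨fun A hA => hS.1 A hA.1, fun _ _ e hA => ⟨hS.2.1 e hA.1, hT.2.1 e hA.2⟩,
    fun A hA => ⟨hS.2.2.1 A hA, hT.2.2.1 A hA⟩,
    fun _ _ g hg hA => ⟨hS.2.2.2.1 g hg hA.1, hT.2.2.2.1 g hg hA.2⟩,
    fun _ _ _ f g hf hg hfg hA hB =>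
      ⟨hS.2.2.2.2 f g hf hg hfg hA.1 hB.1, hT.2.2.2.2 f g hf hg hfg hA.2 hB.2⟩⟩

theorem length_quotient_lt [IsArtinianRing Λ] {X : Type} [AddCommGroup X] [Module Λ X]
    [Module.Finite Λ X] {N : Submodule Λ X} (hN : N ≠ ⊥) :
    Module.length Λ (X ⧸ N) < Module.length Λ X := by
  have : Nontrivial N := Submodule.nontrivial_iff_ne_bot.2 hN
  rw [Module.length_eq_add_of_exact N.subtype N.mkQ N.injective_subtype N.mkQ_surjective
    (LinearMap.exact_subtype_mkQ N), add_comm]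
  simpa using (ENat.add_lt_add_iff_left (k := Module.length Λ (X ⧸ N)) Module.length_ne_top).2
    (Module.length_pos (R := Λ) (M := N))

/-- A wide subcategory not contained in a torsion class has a member `Y` outside of it without
nontrivial subobjects. -/
theorem IsWide.exists_simple_notMem [IsArtinianRing Λ] {W : Set (ModuleCat.{0} Λ)}
    (hW : IsWide Λ W) (hS : IsTorsionClass Λ S) (hWS : ¬ W ⊆ S) :
    ∃ Y : ModuleCat.{0} Λ, Y ∈ W ∧ Y ∉ S ∧
      ∀ N : Submodule Λ Y, ModuleCat.of Λ N ∈ W → N = ⊥ ∨ N = ⊤ := by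
  obtain ⟨Y, ⟨hY, hYS⟩, hmin⟩ := WellFounded.has_min
    (InvImage.wf (fun P : ModuleCat.{0} Λ => Module.length Λ P) wellFounded_lt)
    {Y : ModuleCat.{0} Λ | Y ∈ W ∧ Y ∉ S} (Set.not_subset.1 hWS)
  refine ⟨Y, hY, hYS, fun N hN => ?_⟩
  have := hW.1 Y hY
  by_contra! hne
  have hQ := hW.2.2.2.2.1 (M := ModuleCat.of Λ N) (N := Y) N.subtype hN hY
  rw [Submodule.range_subtype] at hQ
  refine hYS (hS.extClosed.of_submodule N ?_ ?_)
  · by_contra h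
    exact hmin _ ⟨hN, h⟩ (Submodule.length_lt hne.2)
  · by_contra h
    exact hmin _ ⟨hQ, h⟩ (length_quotient_lt hne.1)

/-- Below a functorially finite torsion class, every smaller torsion class is contained in a
smaller functorially finite one. -/
theorem IsTorsionClass.exists_functoriallyFinite_ssubset [IsArtinianRing Λ] [IsHomFinite Λ]
    (hT : IsTorsionClass Λ T) (hff : FunctoriallyFinite Λ T) (hS : IsTorsionClass Λ S)
    (hST : S ⊂ T) :
    ∃ T', IsTorsionClass Λ T' ∧ FunctoriallyFinite Λ T' ∧ S ⊆ T' ∧ T' ⊂ T := by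
  obtain ⟨M, m, hM⟩ := hT.exists_isMinimalGenerator hff.1
  have hW := hM.isWide_evalPerp hT
  have hMf := hT.finite hM.mem
  obtain ⟨Y, hY, hYS, hs⟩ := hW.exists_simple_notMem hS fun h =>
    hST.2 ((hM.torsClosure_evalPerp hT).symm.subset.trans (torsClosure_subset hS h))
  have hYT : Y ∈ T := hM.mem_of_mem_evalPerp hT hY
  let T' := T ∩ lPerp Λ {Y}
  have hT' : IsTorsionClass Λ T' := hT.inter (isTorsionClass_lPerp Λ {Y})
  have hmem : ∀ X : ModuleCat.{0} Λ, X ∈ T → (∀ f : X →ₗ[Λ] Y, f = 0) → X ∈ T' := by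
    intro X hX h
    refine ⟨hX, hT.1 X hX, ?_⟩
    rintro _ rfl
    exact h
  have hzero : ∀ X : ModuleCat.{0} Λ, X ∈ T' → ∀ f : X →ₗ[Λ] Y, f = 0 :=
    fun X hX => hX.2.2 Y rfl
  obtain ⟨V, hV, hVmax⟩ : ∃ V : ModuleCat.{0} Λ,
      (IsRetractOfPow Λ M V ∧ ∀ f : V →ₗ[Λ] Y, f = 0) ∧
      ∀ P : ModuleCat.{0} Λ, IsRetractOfPow Λ M P → (∀ f : P →ₗ[Λ] Y, f = 0) →
        moduleTrace Λ P M ≤ moduleTrace Λ V M := by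
    obtain ⟨_, ⟨V, hV, hV0, rfl⟩, hmax⟩ := set_has_maximal_iff_noetherian.2
      (inferInstanceAs (IsNoetherian Λ M))
      {R : Submodule Λ M | ∃ P : ModuleCat.{0} Λ, IsRetractOfPow Λ M P ∧
        (∀ f : P →ₗ[Λ] Y, f = 0) ∧ R = moduleTrace Λ P M}
      ⟨_, ModuleCat.of Λ (Fin 0 → M), isRetractOfPow_pow 0, fun f => LinearMap.ext fun x => by
        rw [Subsingleton.elim x 0, map_zero, map_zero], rfl⟩
    refine ⟨V, ⟨hV, hV0⟩, fun P hP hP0 => ?_⟩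
    have hlt := hmax _ ⟨ModuleCat.of Λ (V × P), hV.prod hP, fun f => ?_, rfl⟩
    · have h1 : moduleTrace Λ V M ≤ moduleTrace Λ (V × P) M := moduleTrace_le fun f v =>
        apply_mem_moduleTrace (f ∘ₗ LinearMap.fst Λ V P) (v, 0)
      have h2 : moduleTrace Λ P M ≤ moduleTrace Λ (V × P) M := moduleTrace_le fun f v =>
        apply_mem_moduleTrace (f ∘ₗ LinearMap.snd Λ V P) (0, v)
      exact h2.trans (not_lt_iff_le_imp_ge.1 hlt h1)
    · exact LinearMap.prod_ext ((hV0 _).trans (LinearMap.zero_comp _).symm)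
        ((hP0 _).trans (LinearMap.zero_comp _).symm)
  let N := M ⧸ Submodule.span Λ {m}
  have hN : ModuleCat.of Λ N ∈ T := hT.of_surjective hM.mem _ (Submodule.span Λ {m}).mkQ_surjective
  have hVN : ModuleCat.of Λ (V × N) ∈ T' := by
    refine hT'.extClosed.prod (hmem V (hV.1.mem hT hM.mem) hV.2) (hmem _ hN fun f => ?_)
    have h := evalRadical_le_ker hY f
    rw [show evalRadical Λ m N = ⊤ from moduleTrace_self] at h
    exact LinearMap.ker_eq_top.1 (top_le_iff.1 h)
  have hcov : CovariantlyFinite Λ T' := by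
    refine hT'.covariantlyFinite_of_generator hVN fun X hX => eq_top_iff.2 fun x _ => ?_
    have := hT.1 X hX.1
    obtain ⟨P, hP, ⟨p, hp⟩, hP0⟩ := hM.exists_isRetractOfPow hT hY hs
      (hM.quotient_mem_evalPerp hT hX.1) (hzero _
        (hT'.of_surjective hX (evalRadical Λ m X).mkQ (evalRadical Λ m X).mkQ_surjective))
    obtain ⟨k, hk⟩ := hP.exists_lift hT hM (evalRadical Λ m X).mkQ
      (evalRadical Λ m X).mkQ_surjective
      (by rw [Submodule.ker_mkQ]; exact hM.evalRadical_mem hT) p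
    obtain ⟨a, ha⟩ := hp ((evalRadical Λ m X).mkQ x)
    have hxa : x - k a ∈ evalRadical Λ m X := by
      rw [← Submodule.Quotient.mk_eq_zero, Submodule.Quotient.mk_sub, sub_eq_zero]
      exact ha.symm.trans (LinearMap.congr_fun hk a).symm
    have h1 : evalRadical Λ m X ≤ moduleTrace Λ (V × N) X := moduleTrace_le fun f v =>
      apply_mem_moduleTrace (f ∘ₗ LinearMap.snd Λ V N) (0, v)
    have h2 : moduleTrace Λ V X ≤ moduleTrace Λ (V × N) X := moduleTrace_le fun f v =>
      apply_mem_moduleTrace (f ∘ₗ LinearMap.fst Λ V N) (v, 0)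
    have h3 : k a ∈ moduleTrace Λ V X :=
      moduleTrace_le_of_moduleTrace_eq_top (hP.moduleTrace_eq_top (hVmax P hP hP0))
        (apply_mem_moduleTrace k a)
    have := add_mem (h1 hxa) (h2 h3)
    rwa [sub_add_cancel] at this
  refine ⟨T', hT', ⟨hcov, hT'.contravariantlyFinite⟩, fun X hX => ?_, Set.inter_subset_left,
    fun h => ?_⟩
  · refine hmem X (hST.1 hX) fun f => ?_
    refine (hM.eq_zero_or_surjective hY hs hT (hST.1 hX) f).resolve_right fun hf => ?_
    exact hYS (hS.of_surjective hX f hf)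
  · have hid := hzero Y (h hYT) LinearMap.id
    have : Subsingleton Y := ⟨fun a b => by
      rw [← LinearMap.id_apply (R := Λ) a, ← LinearMap.id_apply (R := Λ) b, hid]; rfl⟩
    exact hYS (hS.hasZeroObj Y this)

end Mutation

section Brick

variable {Λ} {S T W : Set (ModuleCat.{0} Λ)} {A B X : ModuleCat.{0} Λ}

theorem isTorsionClass_torsClosure_singleton (hA : FG Λ A) :
    IsTorsionClass Λ (torsClosure Λ {A}) :=
  isTorsionClass_torsClosure fun _ h => h ▸ hA

theorem mem_torsClosure_singleton : A ∈ torsClosure Λ {A} :=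
  subset_torsClosure _ rfl

theorem exists_ne_zero_of_mem_torsClosure (hA : FG Λ A) (hX : X ∈ torsClosure Λ {A})
    [Nontrivial X] : ∃ f : A →ₗ[Λ] X, f ≠ 0 := by
  by_contra! h
  have hsub : torsClosure Λ {A} ⊆ lPerp Λ {X} := by
    refine torsClosure_subset (isTorsionClass_lPerp Λ {X}) ?_
    rintro _ rfl
    refine ⟨hA, ?_⟩
    rintro _ rfl
    exact h
  obtain ⟨x, hx⟩ := exists_ne (0 : X)
  exact hx (LinearMap.congr_fun ((hsub hX).2 X rfl LinearMap.id) x)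

theorem IsBrick.surjective (hA : IsBrick Λ A) (hX : X ∈ torsClosure Λ {A}) (f : X →ₗ[Λ] A)
    (hf : f ≠ 0) : Function.Surjective f := by
  have hR := (isTorsionClass_torsClosure_singleton hA.1).range hX f
  have : Nontrivial (LinearMap.range f) :=
    Submodule.nontrivial_iff_ne_bot.2 fun h => hf (LinearMap.range_eq_bot.1 h)
  obtain ⟨g, hg⟩ := exists_ne_zero_of_mem_torsClosure hA.1 hR
  have hb := hA.2.2 ((LinearMap.range f).subtype ∘ₗ g) fun h =>
    hg (LinearMap.ext fun a => Subtype.ext (LinearMap.congr_fun h a))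
  intro y
  obtain ⟨a, rfl⟩ := hb.2 y
  exact (g a).2

theorem IsBrick.nonempty_equiv (hA : IsBrick Λ A) (hB : IsBrick Λ B)
    (h : torsClosure Λ {A} = torsClosure Λ {B}) : Nonempty (A ≃ₗ[Λ] B) := by
  have := hA.2.1
  have := hB.2.1
  have hAB : A ∈ torsClosure Λ {B} := h ▸ mem_torsClosure_singleton
  have hBA : B ∈ torsClosure Λ {A} := h ▸ mem_torsClosure_singleton
  obtain ⟨f, hf⟩ := exists_ne_zero_of_mem_torsClosure hB.1 hAB
  obtain ⟨g, hg⟩ := exists_ne_zero_of_mem_torsClosure hA.1 hBA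
  have hf := hA.surjective hBA f hf
  have hg := hB.surjective hAB g hg
  have hfg := hA.2.2 (f ∘ₗ g) fun h0 => by
    obtain ⟨x, hx⟩ := exists_ne (0 : A)
    obtain ⟨y, rfl⟩ := (hf.comp hg) x
    exact hx (LinearMap.congr_fun h0 y)
  exact ⟨LinearEquiv.ofBijective g ⟨Function.Injective.of_comp hfg.1, hg⟩⟩

theorem brickFinite_of_finite_torsionClasses (h : {T | IsTorsionClass Λ T}.Finite) :
    BrickFinite Λ := by
  have hI : ((fun A : ModuleCat.{0} Λ => torsClosure Λ {A}) '' {A | IsBrick Λ A}).Finite := by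
    refine h.subset ?_
    rintro _ ⟨A, hA, rfl⟩
    exact isTorsionClass_torsClosure_singleton hA.1
  obtain ⟨t, ht, hbij⟩ := Set.exists_subset_bijOn {A | IsBrick Λ A}
    fun A : ModuleCat.{0} Λ => torsClosure Λ {A}
  refine ⟨t, hbij.finite_iff_finite.2 hI, fun A hA => ?_⟩
  obtain ⟨N, hN, heq⟩ := hbij.surjOn ⟨A, hA, rfl⟩
  exact ⟨N, hN, hA.nonempty_equiv (ht hN) heq.symm⟩

theorem functoriallyFinite_finite : FunctoriallyFinite Λ {M | FG Λ M} :=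
  ⟨fun M hM => ⟨M, hM, LinearMap.id, fun _ _ g => ⟨g, rfl⟩⟩,
    fun M hM => ⟨M, hM, LinearMap.id, fun _ _ g => ⟨g, rfl⟩⟩⟩

theorem finite_torsionClasses [IsArtinianRing Λ] [IsHomFinite Λ]
    (h : {T | IsTorsionClass Λ T ∧ FunctoriallyFinite Λ T}.Finite) :
    {T | IsTorsionClass Λ T}.Finite := by
  refine h.subset fun S hS => ⟨hS, ?_⟩
  obtain ⟨T, ⟨⟨hT, hff⟩, hST⟩, hmin⟩ :=
    (h.subset (t := {T | (IsTorsionClass Λ T ∧ FunctoriallyFinite Λ T) ∧ S ⊆ T})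
      fun T hT => hT.1).exists_minimal
      ⟨_, ⟨isTorsionClass_finite Λ, functoriallyFinite_finite⟩, hS.1⟩
  by_cases hne : S = T
  · exact hne ▸ hff
  · obtain ⟨T', hT', hff', hST', hT'T⟩ :=
      hT.exists_functoriallyFinite_ssubset hff hS (hST.ssubset_of_ne hne)
    exact absurd (hmin ⟨⟨hT', hff'⟩, hST'⟩ hT'T.1) hT'T.2

theorem IsWide.exists_isBrick_submodule [IsArtinianRing Λ] (hW : IsWide Λ W) (hX : X ∈ W)
    [Nontrivial X] : ∃ N : Submodule Λ X, N ≠ ⊥ ∧ ModuleCat.of Λ N ∈ W ∧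
      IsBrick Λ (ModuleCat.of Λ N) := by
  have := hW.1 X hX
  obtain ⟨N, ⟨hN0, hN⟩, hmin⟩ := WellFounded.has_min
    (wellFounded_lt (α := Submodule Λ X))
    {N : Submodule Λ X | N ≠ ⊥ ∧ ModuleCat.of Λ N ∈ W}
    ⟨⊤, top_ne_bot, hW.2.1.of_equiv Submodule.topEquiv.symm hX⟩
  refine ⟨N, hN0, hN, hW.1 _ hN, Submodule.nontrivial_iff_ne_bot.2 hN0, fun f hf => ?_⟩
  let f' : N →ₗ[Λ] N := f
  refine IsArtinian.bijective_of_injective_endomorphism f' (LinearMap.ker_eq_bot.1 ?_)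
  by_contra hK
  have hKW : ModuleCat.of Λ (LinearMap.ker f') ∈ W := hW.2.2.2.1 f hN hN
  refine hmin ((LinearMap.ker f').map N.subtype) ⟨?_, hW.2.1.of_equiv
    (Submodule.equivMapOfInjective N.subtype N.injective_subtype _) hKW⟩
    ((Submodule.map_subtype_le _ _).lt_of_ne fun h => hf ?_)
  · exact fun h => hK (Submodule.map_injective_of_injective N.injective_subtype
      (h.trans (Submodule.map_bot _).symm))
  · refine LinearMap.ext fun x => ?_
    obtain ⟨y, hy, hyx⟩ := h.ge x.2
    rw [← Subtype.ext hyx]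
    exact hy

theorem IsWide.subset_of_forall_isBrick [IsArtinianRing Λ] {W' : Set (ModuleCat.{0} Λ)}
    (hW : IsWide Λ W) (hW' : IsWide Λ W') (h : ∀ B, IsBrick Λ B → B ∈ W → B ∈ W') :
    W ⊆ W' := by
  by_contra hn
  obtain ⟨X, ⟨hX, hXW⟩, hmin⟩ := WellFounded.has_min
    (InvImage.wf (fun P : ModuleCat.{0} Λ => Module.length Λ P) wellFounded_lt)
    {X : ModuleCat.{0} Λ | X ∈ W ∧ X ∉ W'} (Set.not_subset.1 hn)
  have := hW.1 X hX
  rcases subsingleton_or_nontrivial X with hs | hs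
  · exact hXW (hW'.2.2.1 X hs)
  obtain ⟨N, hN0, hN, hNb⟩ := hW.exists_isBrick_submodule hX
  have hQ := hW.2.2.2.2.1 (M := ModuleCat.of Λ N) (N := X) N.subtype hN hX
  rw [Submodule.range_subtype] at hQ
  refine hXW (hW'.2.2.2.2.2.of_submodule N (h _ hNb hN) ?_)
  by_contra hQ'
  exact hmin _ ⟨hQ, hQ'⟩ (length_quotient_lt hN0)

theorem BrickFinite.finite_isWide [IsArtinianRing Λ] (h : BrickFinite Λ) :
    {W | IsWide Λ W}.Finite := by
  obtain ⟨B, hB, hrep⟩ := h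
  refine Set.Finite.of_injOn (f := fun W => B ∩ W) (t := 𝒫 B)
    (fun W _ => Set.inter_subset_left) ?_ hB.finite_subsets
  have key : ∀ W W', IsWide Λ W → IsWide Λ W' → B ∩ W = B ∩ W' → W ⊆ W' := by
    intro W W' hW hW' heq
    refine hW.subset_of_forall_isBrick hW' fun N hN hNW => ?_
    obtain ⟨N₀, hN₀, ⟨e⟩⟩ := hrep N hN
    have : N₀ ∈ B ∩ W' := heq ▸ ⟨hN₀, hW.2.1 ⟨e⟩ hNW⟩
    exact hW'.2.1 ⟨e.symm⟩ this.2
  exact fun W hW W' hW' heq => (key W W' hW hW' heq).antisymm (key W' W hW' hW heq.symm)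

end Brick

/-- `Λ` is brick-finite iff there are only finitely many wide subcategories of
`mod Λ`, iff only finitely many functorially finite ones, iff only finitely many functorially
finite ones `W` with `T(W)` a functorially finite torsion class. -/
theorem brickFinite_iff_finitely_many_wide_subcategories
    (K Λ : Type) [Field K] [Ring Λ] [Algebra K Λ] [FiniteDimensional K Λ] :
    (BrickFinite Λ ↔ {W | IsWide Λ W}.Finite) ∧
    (BrickFinite Λ ↔ {W | IsWide Λ W ∧ FunctoriallyFinite Λ W}.Finite) ∧
    (BrickFinite Λ ↔ {W | IsWide Λ W ∧ FunctoriallyFinite Λ W ∧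
        FunctoriallyFinite Λ (torsClosure Λ W)}.Finite) := by
  have := IsArtinianRing.of_finite K Λ
  have := isHomFinite_of_finiteDimensional (Λ := Λ) K
  have h21 : {W | IsWide Λ W ∧ FunctoriallyFinite Λ W ∧
      FunctoriallyFinite Λ (torsClosure Λ W)} ⊆ {W | IsWide Λ W ∧ FunctoriallyFinite Λ W} :=
    fun W hW => ⟨hW.1, hW.2.1⟩
  have h10 : {W | IsWide Λ W ∧ FunctoriallyFinite Λ W} ⊆ {W | IsWide Λ W} := fun W hW => hW.1
  have h02 : {W | IsWide Λ W ∧ FunctoriallyFinite Λ W ∧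
      FunctoriallyFinite Λ (torsClosure Λ W)}.Finite → BrickFinite Λ := fun h =>
    brickFinite_of_finite_torsionClasses <| finite_torsionClasses <|
      (h.image (torsClosure Λ)).subset fun _ hT => hT.1.exists_isWide_torsClosure_eq hT.2
  exact ⟨⟨fun h => h.finite_isWide, fun h => h02 (h.subset (h21.trans h10))⟩,
    ⟨fun h => h.finite_isWide.subset h10, fun h => h02 (h.subset h21)⟩,
    ⟨fun h => h.finite_isWide.subset (h21.trans h10), h02⟩⟩

end BrickPaper
end

section
/- Let Λ be a finite-dimensional algebra over a field K and let T be a torsion class in mod Λ. Then α(T) = Filt(MCE(T^⊥)), where α(T) = {X ∈ T : for every morphism g : Y → X with Y ∈ T, ker(g) ∈ T}. -/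
open Function DirectSum

namespace BrickPaper

variable (Λ : Type) [Ring Λ]

section TorsionPair

variable {Λ} {T C : Set (ModuleCat.{0} Λ)}

theorem ExtClosed.mem_of_quotient (hC : ExtClosed Λ C) {M : ModuleCat.{0} Λ}
    (N : Submodule Λ M) (hN : ModuleCat.of Λ N ∈ C) (hQ : ModuleCat.of Λ (M ⧸ N) ∈ C) :
    M ∈ C :=
  hC (A := ModuleCat.of Λ N) (B := ModuleCat.of Λ (M ⧸ N)) N.subtype N.mkQ
    N.injective_subtype N.mkQ_surjective (by simp) hN hQ

theorem ExtClosed.comap_mkQ_mem (hC : ExtClosed Λ C) {M : ModuleCat.{0} Λ}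
    (N : Submodule Λ M) (S : Submodule Λ (M ⧸ N)) (hN : ModuleCat.of Λ N ∈ C)
    (hS : ModuleCat.of Λ S ∈ C) : ModuleCat.of Λ (S.comap N.mkQ) ∈ C := by
  have hle : N ≤ S.comap N.mkQ := Submodule.le_comap_mkQ N S
  refine hC (A := ModuleCat.of Λ N) (M := ModuleCat.of Λ (S.comap N.mkQ))
    (B := ModuleCat.of Λ S) (Submodule.inclusion hle)
    (N.mkQ.restrict (p := S.comap N.mkQ) (q := S) fun _ hx => hx)
    (Submodule.inclusion_injective hle) ?_ ?_ hN hS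
  · rintro ⟨y, hy⟩
    obtain ⟨x, rfl⟩ := N.mkQ_surjective y
    exact ⟨⟨x, hy⟩, rfl⟩
  · ext ⟨x, hx⟩
    rw [Submodule.range_inclusion, LinearMap.mem_ker, Subtype.ext_iff]
    simp [LinearMap.restrict_apply]

theorem IsTorsionClass.iso (hT : IsTorsionClass Λ T) {M N : ModuleCat.{0} Λ}
    (e : M ≃ₗ[Λ] N) (hM : M ∈ T) : N ∈ T :=
  hT.2.1 ⟨e⟩ hM

theorem IsTorsionClass.quot (hT : IsTorsionClass Λ T) {M N : ModuleCat.{0} Λ}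
    (g : M →ₗ[Λ] N) (hg : Surjective g) (hM : M ∈ T) : N ∈ T :=
  hT.2.2.2.1 g hg hM

theorem IsTorsionClass.range_mem (hT : IsTorsionClass Λ T) {X M : ModuleCat.{0} Λ}
    (hX : X ∈ T) (f : X →ₗ[Λ] M) : ModuleCat.of Λ (LinearMap.range f) ∈ T :=
  hT.quot (N := ModuleCat.of Λ (LinearMap.range f)) f.rangeRestrict
    f.surjective_rangeRestrict hX

theorem subsingleton_of_mem_rPerp {M : ModuleCat.{0} Λ} (hM : M ∈ T)
    (hF : M ∈ rPerp Λ T) : Subsingleton M :=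
  ⟨fun x y => by
    have h := hF.2 M hM LinearMap.id
    exact (LinearMap.congr_fun h x).trans (LinearMap.congr_fun h y).symm⟩

/-- Every finitely generated module has a torsion part with torsion-free quotient. -/
theorem IsTorsionClass.exists_torsion_part [IsNoetherianRing Λ] (hT : IsTorsionClass Λ T)
    (M : ModuleCat.{0} Λ) [Module.Finite Λ M] :
    ∃ t : Submodule Λ M, ModuleCat.of Λ t ∈ T ∧ ModuleCat.of Λ (M ⧸ t) ∈ rPerp Λ T := by
  obtain ⟨t, ht, hmax⟩ := set_has_maximal_iff_noetherian.mpr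
    (inferInstance : IsNoetherian Λ M) {t : Submodule Λ M | ModuleCat.of Λ t ∈ T}
    ⟨⊥, hT.2.2.1 _ (inferInstanceAs (Subsingleton (⊥ : Submodule Λ M)))⟩
  refine ⟨t, ht, inferInstanceAs (Module.Finite Λ (M ⧸ t)), fun X hX f => ?_⟩
  have hS := hT.2.2.2.2.comap_mkQ_mem t (LinearMap.range f) ht (hT.range_mem hX f)
  have heq : t = (LinearMap.range f).comap t.mkQ :=
    eq_of_le_of_not_lt (Submodule.le_comap_mkQ t _) (hmax _ hS)
  ext x
  obtain ⟨m, hm⟩ := t.mkQ_surjective (f x)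
  have hmt : m ∈ t := by
    rw [heq]
    exact ⟨x, hm.symm⟩
  rw [← hm]
  simpa using hmt

theorem IsTorsionClass.mem_rPerp_of_forall_submodule (hT : IsTorsionClass Λ T)
    {M : ModuleCat.{0} Λ} [Module.Finite Λ M]
    (h : ∀ t : Submodule Λ M, ModuleCat.of Λ t ∈ T → t = ⊥) : M ∈ rPerp Λ T :=
  ⟨inferInstance, fun _ hX f => LinearMap.range_eq_bot.mp (h _ (hT.range_mem hX f))⟩

theorem IsTorsionClass.mem_of_forall_rPerp [IsNoetherianRing Λ] (hT : IsTorsionClass Λ T)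
    {M : ModuleCat.{0} Λ} [Module.Finite Λ M]
    (h : ∀ Y ∈ rPerp Λ T, ∀ f : M →ₗ[Λ] Y, f = 0) : M ∈ T := by
  obtain ⟨t, ht, hF⟩ := hT.exists_torsion_part M
  have htop : t = ⊤ := by
    rw [← Submodule.ker_mkQ t, LinearMap.ker_eq_top]
    exact h _ hF t.mkQ
  subst htop
  exact hT.iso (M := ModuleCat.of Λ (⊤ : Submodule Λ M)) Submodule.topEquiv ht

theorem alphaOf_of_injective {M N : ModuleCat.{0} Λ} (f : M →ₗ[Λ] N) (hf : Injective f) (hN : N ∈ alphaOf Λ T)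
    (hM : M ∈ T) : M ∈ alphaOf Λ T := by
  refine ⟨hM, fun Y g hY => ?_⟩
  have h := hN.2 Y (f ∘ₗ g) hY
  rwa [LinearMap.ker_comp_of_ker_eq_bot g (LinearMap.ker_eq_bot.mpr hf)] at h

theorem IsTorsionClass.alphaOf_iso (hT : IsTorsionClass Λ T) {M N : ModuleCat.{0} Λ}
    (e : M ≃ₗ[Λ] N) (hM : M ∈ alphaOf Λ T) : N ∈ alphaOf Λ T :=
  alphaOf_of_injective (e.symm : N →ₗ[Λ] M) e.symm.injective hM (hT.iso e hM.1)

theorem IsTorsionClass.alphaOf_of_subsingleton (hT : IsTorsionClass Λ T)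
    (M : ModuleCat.{0} Λ) [Subsingleton M] : M ∈ alphaOf Λ T := by
  refine ⟨hT.2.2.1 M inferInstance, fun Y g hY => ?_⟩
  have hg : LinearMap.ker g = ⊤ := LinearMap.ker_eq_top.mpr (Subsingleton.elim _ _)
  rw [hg]
  exact hT.iso (N := ModuleCat.of Λ (⊤ : Submodule Λ Y)) Submodule.topEquiv.symm hY

theorem IsTorsionClass.extClosed_alphaOf (hT : IsTorsionClass Λ T) :
    ExtClosed Λ (alphaOf Λ T) := by
  intro A X B i p hi hp hip hA hB
  refine ⟨hT.2.2.2.2 i p hi hp hip hA.1 hB.1, fun Y g hY => ?_⟩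
  have hK := hB.2 Y (p ∘ₗ g) hY
  have hrange (y : LinearMap.ker (p ∘ₗ g)) : g y ∈ LinearMap.range i := by
    rw [hip]
    exact y.2
  let φ : LinearMap.ker (p ∘ₗ g) →ₗ[Λ] A :=
    (LinearEquiv.ofInjective i hi).symm.toLinearMap ∘ₗ
      (g.domRestrict (LinearMap.ker (p ∘ₗ g))).codRestrict (LinearMap.range i) hrange
  have hφ (y : LinearMap.ker (p ∘ₗ g)) : i (φ y) = g y :=
    congrArg Subtype.val ((LinearEquiv.ofInjective i hi).apply_symm_apply ⟨g y, hrange y⟩)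
  have hL := hA.2 (ModuleCat.of Λ (LinearMap.ker (p ∘ₗ g))) φ hK
  have hker (y : LinearMap.ker φ) : g y.1 = 0 := by
    rw [← hφ, LinearMap.mem_ker.mp y.2, map_zero]
  refine hT.quot (M := ModuleCat.of Λ (LinearMap.ker φ)) (N := ModuleCat.of Λ (LinearMap.ker g))
    (((LinearMap.ker (p ∘ₗ g)).subtype ∘ₗ (LinearMap.ker φ).subtype).codRestrict
      (LinearMap.ker g) hker) ?_ hL
  rintro ⟨y, hy⟩
  have hy' : y ∈ LinearMap.ker (p ∘ₗ g) := by
    rw [LinearMap.mem_ker, LinearMap.comp_apply, LinearMap.mem_ker.mp hy, map_zero]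
  refine ⟨⟨⟨y, hy'⟩, hi ?_⟩, rfl⟩
  rw [hφ, map_zero]
  exact hy

theorem IsTorsionClass.alphaOf_quotient (hT : IsTorsionClass Λ T) {X : ModuleCat.{0} Λ}
    (S : Submodule Λ X) (hX : X ∈ alphaOf Λ T) (hS : ModuleCat.of Λ S ∈ T) :
    ModuleCat.of Λ (X ⧸ S) ∈ alphaOf Λ T := by
  refine ⟨hT.quot (N := ModuleCat.of Λ (X ⧸ S)) S.mkQ S.mkQ_surjective hX.1,
    fun Y g hY => ?_⟩
  -- the pullback of `g` along the projection `X → X ⧸ S`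
  let d : (Y × X) →ₗ[Λ] (X ⧸ S) := g ∘ₗ LinearMap.fst Λ Y X - S.mkQ ∘ₗ LinearMap.snd Λ Y X
  have hd (z : Y × X) : z ∈ LinearMap.ker d ↔ g z.1 = S.mkQ z.2 := by
    rw [LinearMap.mem_ker]
    exact sub_eq_zero
  have hP : ModuleCat.of Λ (LinearMap.ker d) ∈ T := by
    refine hT.2.2.2.2 (A := ModuleCat.of Λ S) (M := ModuleCat.of Λ (LinearMap.ker d)) (B := Y)
      ((LinearMap.inr Λ Y X ∘ₗ S.subtype).codRestrict (LinearMap.ker d) fun s => ?_)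
      (LinearMap.fst Λ Y X ∘ₗ (LinearMap.ker d).subtype) ?_ ?_ ?_ hS hY
    · rw [hd]
      exact (map_zero g).trans ((Submodule.Quotient.mk_eq_zero S).mpr s.2).symm
    · intro a b hab
      exact Subtype.ext (congrArg (fun z : LinearMap.ker d => z.1.2) hab)
    · intro y
      obtain ⟨x, hx⟩ := S.mkQ_surjective (g y)
      exact ⟨⟨(y, x), (hd _).mpr hx.symm⟩, rfl⟩
    · ext z
      constructor
      · rintro ⟨s, rfl⟩
        rfl
      · intro hz
        have hz1 : z.1.1 = 0 := hz
        have hz2 : z.1.2 ∈ S := by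
          have h := (hd z.1).mp z.2
          rw [hz1, map_zero] at h
          simpa using h.symm
        exact ⟨⟨z.1.2, hz2⟩, Subtype.ext (Prod.ext hz1.symm rfl)⟩
  have hK := hX.2 (ModuleCat.of Λ (LinearMap.ker d))
    (LinearMap.snd Λ Y X ∘ₗ (LinearMap.ker d).subtype) hP
  refine hT.quot (N := ModuleCat.of Λ (LinearMap.ker g))
    ((LinearMap.fst Λ Y X ∘ₗ (LinearMap.ker d).subtype ∘ₗ
      (LinearMap.ker (LinearMap.snd Λ Y X ∘ₗ (LinearMap.ker d).subtype)).subtype).codRestrict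
        (LinearMap.ker g) fun z => ?_) ?_ hK
  · have hz : z.1.1.2 = 0 := z.2
    have h := (hd z.1.1).mp z.1.2
    rw [hz, map_zero] at h
    exact h
  · rintro ⟨y, hy⟩
    refine ⟨⟨⟨(y, 0), (hd _).mpr ?_⟩, rfl⟩, rfl⟩
    rw [map_zero]
    exact hy

theorem IsTorsionClass.mce_subset_alphaOf [IsNoetherianRing Λ] (hT : IsTorsionClass Λ T) :
    MCE Λ (rPerp Λ T) ⊆ alphaOf Λ T := by
  rintro M ⟨hfg, hnt, hsub, hext, hperp⟩
  refine ⟨hT.mem_of_forall_rPerp hperp, fun Y g hY => ?_⟩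
  have := hT.1 Y hY
  by_cases hg : LinearMap.range g = ⊤
  · have hker : Module.Finite Λ (ModuleCat.of Λ (LinearMap.ker g)) :=
      inferInstanceAs (Module.Finite Λ (LinearMap.ker g))
    obtain ⟨t, ht, hF⟩ := hT.exists_torsion_part (ModuleCat.of Λ (LinearMap.ker g))
    let t' : Submodule Λ (LinearMap.ker g) := t
    let s : Submodule Λ Y := t'.map (LinearMap.ker g).subtype
    have hs : s ≤ LinearMap.ker g := Submodule.map_subtype_le _ _
    have hts : t' ≤ s.comap (LinearMap.ker g).subtype := Submodule.le_comap_map _ _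
    have hQ : ModuleCat.of Λ (Y ⧸ s) ∈ T :=
      hT.quot (N := ModuleCat.of Λ (Y ⧸ s)) s.mkQ s.mkQ_surjective hY
    let i : (LinearMap.ker g ⧸ t') →ₗ[Λ] (Y ⧸ s) := t'.mapQ s (LinearMap.ker g).subtype hts
    let p : (Y ⧸ s) →ₗ[Λ] M := s.liftQ g hs
    have hi : Injective i := by
      rw [← LinearMap.ker_eq_bot]
      refine Submodule.ker_liftQ_eq_bot _ _ _ fun k hk => ?_
      obtain ⟨k', hk', he⟩ := (Submodule.Quotient.mk_eq_zero s).mp (LinearMap.mem_ker.mp hk)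
      rwa [← Subtype.ext he]
    have hp : Surjective p := by
      intro m
      obtain ⟨y, rfl⟩ := LinearMap.range_eq_top.mp hg m
      exact ⟨s.mkQ y, rfl⟩
    have hip : LinearMap.range i = LinearMap.ker p := by
      ext z
      constructor
      · rintro ⟨k, rfl⟩
        obtain ⟨k, rfl⟩ := t'.mkQ_surjective k
        exact k.2
      · obtain ⟨y, rfl⟩ := s.mkQ_surjective z
        intro hy
        exact ⟨t'.mkQ ⟨y, hy⟩, rfl⟩
    by_cases hsplit : ∃ σ : M →ₗ[Λ] (Y ⧸ s), p ∘ₗ σ = LinearMap.id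
    · obtain ⟨σ, hσ⟩ := hsplit
      have hσ' (m : M) : p (σ m) = m := LinearMap.congr_fun hσ m
      have hmem (z : Y ⧸ s) : z - σ (p z) ∈ LinearMap.range i := by
        rw [hip, LinearMap.mem_ker, map_sub, hσ', sub_self]
      let r : (Y ⧸ s) →ₗ[Λ] LinearMap.range i :=
        (LinearMap.id - σ ∘ₗ p).codRestrict (LinearMap.range i) hmem
      have hr : Surjective r := by
        rintro ⟨z, hz⟩
        refine ⟨z, Subtype.ext ?_⟩
        have hz0 : p z = 0 := by
          rw [hip] at hz
          exact hz
        change z - σ (p z) = z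
        rw [hz0, map_zero, sub_zero]
      have hqT : ModuleCat.of Λ (LinearMap.ker g ⧸ t') ∈ T :=
        hT.quot (M := ModuleCat.of Λ (Y ⧸ s)) (N := ModuleCat.of Λ (LinearMap.ker g ⧸ t'))
          ((LinearEquiv.ofInjective i hi).symm.toLinearMap ∘ₗ r)
          ((LinearEquiv.ofInjective i hi).symm.surjective.comp hr) hQ
      exact hT.2.2.2.2.mem_of_quotient t ht hqT
    · have hX := hext (ModuleCat.of Λ (Y ⧸ s)) _ i p hi hp hip hF hsplit
      have := subsingleton_of_mem_rPerp hQ hX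
      exact absurd hp.subsingleton (not_subsingleton M)
  · have := subsingleton_of_mem_rPerp (hT.range_mem hY g) (hsub _ hg)
    have hker : LinearMap.ker g = ⊤ := by
      rw [LinearMap.ker_eq_top, ← LinearMap.range_eq_bot]
      exact Submodule.subsingleton_iff_eq_bot.mp this
    rw [hker]
    exact hT.iso (N := ModuleCat.of Λ (⊤ : Submodule Λ Y)) Submodule.topEquiv.symm hY

theorem IsTorsionClass.mem_mce_of_minimal [IsNoetherianRing Λ] (hT : IsTorsionClass Λ T)
    {M : ModuleCat.{0} Λ} [Nontrivial M] (hM : M ∈ alphaOf Λ T)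
    (hmin : ∀ S : Submodule Λ M, ModuleCat.of Λ S ∈ T → S = ⊥ ∨ S = ⊤) :
    M ∈ MCE Λ (rPerp Λ T) := by
  have hfg := hT.1 M hM.1
  refine ⟨hfg, inferInstance, fun S hS => ?_, fun X F' f g hf hg hfg' hF hsplit => ?_,
    fun Y hY f => hY.2 M hM.1 f⟩
  · have : Module.Finite Λ (ModuleCat.of Λ S) := inferInstanceAs (Module.Finite Λ S)
    refine hT.mem_rPerp_of_forall_submodule fun t ht => ?_
    let t' : Submodule Λ S := t
    have ht' : ModuleCat.of Λ (t'.map S.subtype) ∈ T :=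
      hT.iso (M := ModuleCat.of Λ t') (N := ModuleCat.of Λ (t'.map S.subtype))
        (Submodule.equivMapOfInjective _ S.injective_subtype t') ht
    rcases hmin _ ht' with h | h
    · exact Submodule.map_injective_of_injective S.injective_subtype (h.trans (Submodule.map_bot _).symm)
    · exact absurd (top_le_iff.mp (h ▸ Submodule.map_subtype_le S t')) hS
  · have := hF.1
    have : Module.Finite Λ X := Module.Finite.of_exact (LinearMap.exact_iff.mpr hfg'.symm) hg
    refine hT.mem_rPerp_of_forall_submodule fun t ht => ?_
    have hK := hM.2 (ModuleCat.of Λ t) (g.domRestrict t) ht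
    have hgt : Injective (g.domRestrict t) := by
      rw [← LinearMap.ker_eq_bot]
      have hmem (k : LinearMap.ker (g.domRestrict t)) : (k.1.1 : X) ∈ LinearMap.range f := by
        rw [hfg']
        exact k.2
      have h0 := hF.2 _ hK ((LinearEquiv.ofInjective f hf).symm.toLinearMap ∘ₗ
        (t.subtype ∘ₗ (LinearMap.ker (g.domRestrict t)).subtype).codRestrict
          (LinearMap.range f) hmem)
      rw [Submodule.eq_bot_iff]
      intro k hk
      have h1 := LinearMap.congr_fun h0 (⟨k, hk⟩ : LinearMap.ker (g.domRestrict t))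
      have h2 := (LinearEquiv.ofInjective f hf).symm.injective (h1.trans (map_zero _).symm)
      have h3 : k.1 = 0 := congrArg Subtype.val h2
      exact Subtype.ext h3
    have hR := hT.range_mem (X := ModuleCat.of Λ t) ht (g.domRestrict t)
    rcases hmin _ hR with h | h
    · rw [LinearMap.range_eq_bot] at h
      rw [Submodule.eq_bot_iff]
      intro x hx
      have h1 : (⟨x, hx⟩ : t) = 0 := hgt (by rw [h]; rfl)
      exact congrArg Subtype.val h1
    · refine absurd ⟨t.subtype ∘ₗ (LinearEquiv.ofBijective (g.domRestrict t)
        ⟨hgt, LinearMap.range_eq_top.mp h⟩).symm.toLinearMap, ?_⟩ hsplit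
      ext m
      exact (LinearEquiv.ofBijective (g.domRestrict t)
        ⟨hgt, LinearMap.range_eq_top.mp h⟩).apply_symm_apply m

theorem IsTorsionClass.exists_submodule_mem_mce [IsNoetherianRing Λ] [IsArtinianRing Λ]
    (hT : IsTorsionClass Λ T) {X : ModuleCat.{0} Λ} [Nontrivial X] (hX : X ∈ alphaOf Λ T) :
    ∃ S : Submodule Λ X, S ≠ ⊥ ∧ ModuleCat.of Λ S ∈ MCE Λ (rPerp Λ T) := by
  have := hT.1 X hX.1
  obtain ⟨S, ⟨hS0, hS⟩, hmin⟩ := IsArtinian.set_has_minimal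
    {S : Submodule Λ X | S ≠ ⊥ ∧ ModuleCat.of Λ S ∈ T}
    ⟨⊤, top_ne_bot, hT.iso (N := ModuleCat.of Λ (⊤ : Submodule Λ X))
      Submodule.topEquiv.symm hX.1⟩
  refine ⟨S, hS0, ?_⟩
  have : Nontrivial (ModuleCat.of Λ S) := Submodule.nontrivial_iff_ne_bot.mpr hS0
  refine hT.mem_mce_of_minimal
    (alphaOf_of_injective (M := ModuleCat.of Λ S) S.subtype S.injective_subtype hX hS)
    fun t ht => ?_
  let t' : Submodule Λ S := t
  have ht' : ModuleCat.of Λ (t'.map S.subtype) ∈ T :=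
    hT.iso (M := ModuleCat.of Λ t') (N := ModuleCat.of Λ (t'.map S.subtype))
      (Submodule.equivMapOfInjective _ S.injective_subtype t') ht
  by_cases h : t'.map S.subtype = ⊥
  · exact .inl (Submodule.map_injective_of_injective S.injective_subtype (h.trans (Submodule.map_bot _).symm))
  · right
    have heq := eq_of_le_of_not_lt (Submodule.map_subtype_le S t') (hmin _ ⟨h, ht'⟩)
    refine eq_top_iff.mpr fun x _ => ?_
    have hx : (x : X) ∈ t'.map S.subtype := heq.ge x.2
    obtain ⟨y, hy, hyx⟩ := hx
    rwa [← Subtype.ext hyx]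

/-- There is a finite chain from `⊥` to `N` with subquotients isomorphic to members of `B`. -/
def HasFiltrationTo (B : Set (ModuleCat.{0} Λ)) {M : ModuleCat.{0} Λ} (N : Submodule Λ M) :
    Prop :=
  ∃ (n : ℕ) (c : Fin (n + 1) → Submodule Λ M), Monotone c ∧ c 0 = ⊥ ∧ c (Fin.last n) = N ∧
    ∀ i : Fin n, ∃ N ∈ B,
      Nonempty ((↥(c i.succ) ⧸ Submodule.comap (c i.succ).subtype (c i.castSucc)) ≃ₗ[Λ] N)

theorem HasFiltrationTo.step {B : Set (ModuleCat.{0} Λ)} {M : ModuleCat.{0} Λ}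
    {N P : Submodule Λ M} (hN : HasFiltrationTo B N) (hNP : N ≤ P)
    (hP : ∃ Q ∈ B, Nonempty ((P ⧸ N.comap P.subtype) ≃ₗ[Λ] Q)) : HasFiltrationTo B P := by
  obtain ⟨n, c, hmono, h0, hlast, hc⟩ := hN
  refine ⟨n + 1, Fin.snoc (α := fun _ => Submodule Λ M) c P,
    Fin.monotone_iff_le_succ.mpr fun i => ?_, ?_, Fin.snoc_last _ _, fun i => ?_⟩
  · induction i using Fin.lastCases with
    | last => rwa [Fin.snoc_castSucc, Fin.succ_last, Fin.snoc_last, hlast]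
    | cast i =>
      rw [Fin.snoc_castSucc, Fin.succ_castSucc, Fin.snoc_castSucc]
      exact hmono i.castSucc_lt_succ.le
  · rw [← Fin.castSucc_zero, Fin.snoc_castSucc, h0]
  · induction i using Fin.lastCases with
    | last => rwa [Fin.snoc_castSucc, Fin.succ_last, Fin.snoc_last, hlast]
    | cast i =>
      rw [Fin.snoc_castSucc, Fin.succ_castSucc, Fin.snoc_castSucc]
      exact hc i

/-- The subquotient cut out by a submodule of a quotient module. -/
noncomputable def comapMkQQuotientEquiv {M : ModuleCat.{0} Λ} (N : Submodule Λ M)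
    (S : Submodule Λ (M ⧸ N)) :
    (S.comap N.mkQ ⧸ N.comap (S.comap N.mkQ).subtype) ≃ₗ[Λ] S :=
  let φ : S.comap N.mkQ →ₗ[Λ] S := N.mkQ.restrict fun _ hx => hx
  have hker : N.comap (S.comap N.mkQ).subtype = LinearMap.ker φ := by
    ext ⟨x, hx⟩
    rw [LinearMap.mem_ker, Subtype.ext_iff]
    simp [φ, LinearMap.restrict_apply]
  (Submodule.quotEquivOfEq _ _ hker).trans <| φ.quotKerEquivOfSurjective <| by
    rintro ⟨y, hy⟩
    obtain ⟨x, rfl⟩ := N.mkQ_surjective y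
    exact ⟨⟨x, hy⟩, rfl⟩

theorem IsTorsionClass.alphaOf_subset_filtClosure [IsNoetherianRing Λ] [IsArtinianRing Λ]
    (hT : IsTorsionClass Λ T) : alphaOf Λ T ⊆ filtClosure Λ (MCE Λ (rPerp Λ T)) := by
  intro X hX
  have := hT.1 X hX.1
  obtain ⟨N, ⟨hN, hα⟩, hmax⟩ := set_has_maximal_iff_noetherian.mpr
    (inferInstance : IsNoetherian Λ X)
    {N : Submodule Λ X | HasFiltrationTo (MCE Λ (rPerp Λ T)) N ∧
      ModuleCat.of Λ (X ⧸ N) ∈ alphaOf Λ T}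
    ⟨⊥, ⟨0, fun _ => ⊥, monotone_const, rfl, rfl, fun i => i.elim0⟩,
      hT.alphaOf_iso (N := ModuleCat.of Λ (X ⧸ (⊥ : Submodule Λ X)))
        (Submodule.quotEquivOfEqBot ⊥ rfl).symm hX⟩
  by_cases htop : N = ⊤
  · subst htop
    exact hN
  · have : Nontrivial (ModuleCat.of Λ (X ⧸ N)) := Submodule.Quotient.nontrivial_iff.mpr htop
    obtain ⟨S, hS0, hS⟩ := hT.exists_submodule_mem_mce hα
    let S' : Submodule Λ (X ⧸ N) := S
    have hle : N ≤ S'.comap N.mkQ := Submodule.le_comap_mkQ N S'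
    refine absurd (lt_of_le_of_ne hle fun heq => hS0 ?_) (hmax (S'.comap N.mkQ) ⟨?_, ?_⟩)
    · have h := Submodule.map_comap_eq_of_surjective N.mkQ_surjective S'
      rw [← heq, Submodule.mkQ_map_self] at h
      exact h.symm
    · exact hN.step hle ⟨_, hS, ⟨comapMkQQuotientEquiv N S'⟩⟩
    · have hST : ModuleCat.of Λ S' ∈ T := (hT.mce_subset_alphaOf hS).1
      have h := hT.alphaOf_quotient S hα hST
      have hker : S'.comap N.mkQ = LinearMap.ker (S'.mkQ ∘ₗ N.mkQ) := by
        rw [LinearMap.ker_comp, Submodule.ker_mkQ]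
      exact hT.alphaOf_iso (M := ModuleCat.of Λ ((X ⧸ N) ⧸ S'))
        (N := ModuleCat.of Λ (X ⧸ S'.comap N.mkQ))
        ((Submodule.quotEquivOfEq _ _ hker).trans
          ((S'.mkQ ∘ₗ N.mkQ).quotKerEquivOfSurjective
            (S'.mkQ_surjective.comp N.mkQ_surjective))).symm h

theorem IsTorsionClass.filtClosure_subset_alphaOf [IsNoetherianRing Λ]
    (hT : IsTorsionClass Λ T) : filtClosure Λ (MCE Λ (rPerp Λ T)) ⊆ alphaOf Λ T := by
  rintro X ⟨n, c, hmono, h0, hlast, hc⟩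
  have key (i : Fin (n + 1)) : ModuleCat.of Λ (c i) ∈ alphaOf Λ T := by
    induction i using Fin.induction with
    | zero =>
      rw [h0]
      have : Subsingleton (ModuleCat.of Λ (⊥ : Submodule Λ X)) :=
        inferInstanceAs (Subsingleton (⊥ : Submodule Λ X))
      exact hT.alphaOf_of_subsingleton _
    | succ i ih =>
      obtain ⟨Q, hQ, ⟨e⟩⟩ := hc i
      have hle : c i.castSucc ≤ c i.succ := hmono i.castSucc_lt_succ.le
      refine hT.extClosed_alphaOf.mem_of_quotient (M := ModuleCat.of Λ (c i.succ))
        ((c i.castSucc).comap (c i.succ).subtype) ?_ ?_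
      · exact hT.alphaOf_iso (M := ModuleCat.of Λ (c i.castSucc))
          (N := ModuleCat.of Λ ((c i.castSucc).comap (c i.succ).subtype))
          (Submodule.comapSubtypeEquivOfLe hle).symm ih
      · exact hT.alphaOf_iso (N := ModuleCat.of Λ
          (c i.succ ⧸ (c i.castSucc).comap (c i.succ).subtype)) e.symm
          (hT.mce_subset_alphaOf hQ)
  have h := key (Fin.last n)
  rw [hlast] at h
  exact hT.alphaOf_iso (M := ModuleCat.of Λ (⊤ : Submodule Λ X)) Submodule.topEquiv h

end TorsionPair

/-- For a torsion class `T` in `mod Λ`, `α(T) = Filt(MCE(T^⊥))`. -/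
theorem alpha_eq_filt_MCE
    (K Λ : Type) [Field K] [Ring Λ] [Algebra K Λ] [FiniteDimensional K Λ]
    (T : Set (ModuleCat.{0} Λ)) (hT : IsTorsionClass Λ T) :
    alphaOf Λ T = filtClosure Λ (MCE Λ (rPerp Λ T)) := by
  have : IsNoetherianRing Λ := isNoetherian_of_tower K inferInstance
  have : IsArtinianRing Λ := isArtinian_of_tower K inferInstance
  exact hT.alphaOf_subset_filtClosure.antisymm hT.filtClosure_subset_alphaOf

end BrickPaper
end
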